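/- arXiv:2212.04756 — 3 statements merged into one kernel-verified Lean document; each statement's English description precedes it below -/
import Mathlib

section
/- Let G, H : ℝ^n → ℝ^m be maps each of whose component functions is a (multivariate real) polynomial function, let S = {x ∈ ℝ^n : G(x) ≥ 0, H(x) ≥ 0, G(x)ᵀH(x) = 0} and, for σ > 0, S_σ = {x ∈ ℝ^n : G(x) ≥ 0, H(x) ≥ 0, G(x)ᵀH(x) ≤ σ}. Assume S is nonempty. Then there exist constants β > 0, τ > 0 and γ ≥ 0 such that for every σ > 0 and every x ∈ S_σ, dist(x, S) ≤ β (1 + ‖x‖)^γ σ^τ. -/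
open scoped BigOperators

section HenselianResidue

open Polynomial

/-- A henselian valuation ring of equal characteristic zero has a field of representatives for its
residue field, which may be chosen to contain a given subfield. -/
theorem exists_coefficient_subfield {K : Type*} [Field K] [CharZero K] (A : ValuationSubring K)
    [HenselianLocalRing A] (F₀ : Subfield K) (hF₀ : ∀ x ∈ F₀, x ∈ A) :
    ∃ F : Subfield K, F₀ ≤ F ∧ (∀ x ∈ F, x ∈ A) ∧
      ∀ a ∈ A, ∃ f ∈ F, A.valuation (a - f) < 1 := by
  obtain ⟨F, hle, hFA, hmax⟩ := zorn_le_nonempty₀ {F : Subfield K | ∀ x ∈ F, x ∈ A} (by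
    intro c hc hchain y hy
    refine ⟨sSup c, ?_, fun z hz => le_sSup hz⟩
    intro x hx
    rw [Subfield.mem_sSup_of_directedOn ⟨y, hy⟩ hchain.directedOn] at hx
    obtain ⟨s, hs, hxs⟩ := hx
    exact hc hs x hxs) F₀ hF₀
  refine ⟨F, hle, hFA, fun a ha => ?_⟩
  let i : F →+* A := F.subtype.codRestrict A.toSubring (fun x => hFA x x.2)
  let : Algebra F (IsLocalRing.ResidueField A) := ((IsLocalRing.residue A).comp i).toAlgebra
  have hiK : ∀ (s : F[X]) (β : A), ((s.eval₂ i β : A) : K) = aeval (β : K) s := by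
    intro s β
    exact hom_eval₂ s i A.subtype β
  have hires : ∀ (s : F[X]) (β : A), IsLocalRing.residue A (s.eval₂ i β) =
      aeval (IsLocalRing.residue A β) s := by
    intro s β
    exact hom_eval₂ s i (IsLocalRing.residue A) β
  let b := IsLocalRing.residue A ⟨a, ha⟩
  have key : ∃ β : A, IsLocalRing.residue A β = b ∧
      ∀ s : F[X], aeval b s = 0 → s.eval₂ i β = 0 := by
    by_cases halg : IsIntegral F b
    · have hroot : aeval b (minpoly F b) = 0 := minpoly.aeval F b
      obtain ⟨β, hβ, hβa⟩ := HenselianLocalRing.is_henselian ((minpoly F b).map i)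
        ((minpoly.monic halg).map i) ⟨a, ha⟩ (by
          rw [eval_map, ← IsLocalRing.residue_eq_zero_iff, hires]
          exact hroot) (by
          rw [derivative_map, eval_map, ← IsLocalRing.residue_ne_zero_iff_isUnit, hires]
          exact (minpoly.irreducible halg).separable.aeval_derivative_ne_zero hroot)
      refine ⟨β, ?_, fun s hs => ?_⟩
      · rwa [← IsLocalRing.residue_eq_zero_iff, map_sub, sub_eq_zero] at hβa
      · obtain ⟨q, rfl⟩ := minpoly.dvd F b hs
        rw [eval₂_mul, ← eval_map, hβ.eq_zero, zero_mul]
    · refine ⟨⟨a, ha⟩, rfl, fun s hs => ?_⟩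
      rw [← isAlgebraic_iff_isIntegral] at halg
      have : s = 0 := by
        by_contra h
        exact halg ⟨s, h, hs⟩
      simp [this]
  obtain ⟨β, hβb, hβ⟩ := key
  have hadj : ∀ x ∈ (IntermediateField.adjoin F {(β : K)}).toSubfield, x ∈ A := by
    intro x hx
    obtain ⟨r, s, rfl⟩ := (IntermediateField.mem_adjoin_simple_iff F x).1 hx
    rw [← hiK, ← hiK]
    by_cases h0 : s.eval₂ i β = 0
    · simp [h0, A.zero_mem]
    · have hu : IsUnit (s.eval₂ i β) := by
        rw [← IsLocalRing.residue_ne_zero_iff_isUnit, hires, hβb]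
        exact fun h => h0 (hβ s h)
      obtain ⟨u, hu⟩ := hu
      have : ((s.eval₂ i β : A) : K)⁻¹ = ((u⁻¹ : Aˣ) : A) := by
        rw [← hu]
        apply inv_eq_of_mul_eq_one_right
        exact_mod_cast congrArg (fun z : A => (z : K)) u.mul_inv
      rw [div_eq_mul_inv, this]
      exact A.mul_mem _ _ (Subtype.property _) (Subtype.property _)
  have hβF : (β : K) ∈ F := by
    refine hmax (y := (IntermediateField.adjoin F {(β : K)}).toSubfield) hadj ?_ ?_
    · intro x hx
      exact (IntermediateField.adjoin F {(β : K)}).algebraMap_mem ⟨x, hx⟩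
    · exact IntermediateField.mem_adjoin_simple_self F (β : K)
  refine ⟨β, hβF, ?_⟩
  have : (⟨a, ha⟩ - β : A) ∈ IsLocalRing.maximalIdeal A := by
    rw [← IsLocalRing.residue_eq_zero_iff, map_sub, hβb, sub_self]
  exact (A.valuation_lt_one_iff _).1 this

/-- In an ordered field with the intermediate value property for polynomials, every convex
valuation ring is henselian. -/
theorem henselianLocalRing_of_intermediate_value {K : Type*} [Field K] [LinearOrder K]
    [IsStrictOrderedRing K] (A : ValuationSubring K)
    (hA : ∀ x y : K, |x| ≤ |y| → A.valuation x ≤ A.valuation y)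
    (hK : ∀ (p : K[X]) (a b : K), p.eval a * p.eval b ≤ 0 → ∃ c ∈ Set.uIcc a b, p.eval c = 0) :
    HenselianLocalRing A where
  is_henselian f _ a ha hu := by
    obtain ⟨u, hu⟩ := hu
    have heval : ∀ z : A, (f.map A.subtype).eval (z : K) = ((f.eval z : A) : K) := by
      intro z
      rw [eval_map]
      exact (hom_eval₂ f (RingHom.id A) A.subtype z).symm
    set e := f.eval a with he
    set h : A := 2 * e * ↑u⁻¹ with hh
    have hh_mem : h ∈ IsLocalRing.maximalIdeal A :=
      Ideal.mul_mem_right _ _ (Ideal.mul_mem_left _ _ ha)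
    have huu : (u : A) * ↑u⁻¹ = 1 := u.mul_inv
    have expand : ∀ s : A, s ^ 2 = 1 → ∃ δ : K, |δ| < 1 ∧
        ((f.eval (a + s * h) : A) : K) = e * (1 + 2 * s + δ) := by
      intro s hs
      obtain ⟨q, hq⟩ := f.binomExpansion a (s * h)
      refine ⟨((q * 4 * e * ↑u⁻¹ ^ 2 : A) : K), ?_, ?_⟩
      · by_contra hcon
        rw [not_lt] at hcon
        have h1 := hA 1 _ (abs_one.trans_le hcon)
        have h2 : (q * 4 * e * ↑u⁻¹ ^ 2 : A) ∈ IsLocalRing.maximalIdeal A :=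
          Ideal.mul_mem_right _ _ (Ideal.mul_mem_left _ _ ha)
        rw [A.valuation_lt_one_iff] at h2
        rw [map_one] at h1
        exact absurd h2 (not_lt.2 h1)
      · have : f.eval (a + s * h) = e * (1 + 2 * s + q * 4 * e * ↑u⁻¹ ^ 2) := by
          rw [hq, ← hu, ← he, hh]
          linear_combination (2 * s * e) * huu + q * 4 * e ^ 2 * ↑u⁻¹ ^ 2 * hs
        rw [this]
        push_cast
        rfl
    obtain ⟨δ₁, hδ₁, h1⟩ := expand 1 (by ring)
    obtain ⟨δ₂, hδ₂, h2⟩ := expand (-1) (by ring)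
    rw [abs_lt] at hδ₁ hδ₂
    obtain ⟨c, hc, hc0⟩ := hK (f.map A.subtype) ((a + 1 * h : A) : K) ((a + (-1) * h : A) : K) (by
      rw [heval, heval, h1, h2]
      push_cast
      have : 0 ≤ (1 + 2 * 1 + δ₁) * (1 - δ₂) := mul_nonneg (by linarith) (by linarith)
      nlinarith [mul_nonneg (mul_self_nonneg (e : K)) this])
    have hca : |c - a| ≤ |(h : K)| := by
      push_cast at hc
      rcases Set.mem_uIcc.1 hc with ⟨h3, h4⟩ | ⟨h3, h4⟩
      · rw [abs_le']; constructor <;> linarith [neg_le_abs (h : K)]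
      · rw [abs_le']; constructor <;> linarith [le_abs_self (h : K)]
    have hlt : A.valuation (c - a) < 1 :=
      (hA _ _ hca).trans_lt ((A.valuation_lt_one_iff _).1 hh_mem)
    have hcA : c - a ∈ A := (A.valuation_le_one_iff _).1 hlt.le
    refine ⟨⟨c - a, hcA⟩ + a, ?_, ?_⟩
    · apply Subtype.val_injective
      rw [← heval]
      simpa using hc0
    · rw [add_sub_cancel_right]
      exact (A.valuation_lt_one_iff _).2 hlt

/-- Ultrapowers of `ℝ` have the intermediate value property for polynomials. -/
theorem exists_mem_uIcc_eval_eq_zero_of_germ {α : Type*} (φ : Ultrafilter α)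
    (p : Polynomial (Filter.Germ (φ : Filter α) ℝ)) (a b : Filter.Germ (φ : Filter α) ℝ)
    (h : p.eval a * p.eval b ≤ 0) : ∃ c ∈ Set.uIcc a b, p.eval c = 0 := by
  obtain ⟨P, rfl⟩ := Polynomial.map_surjective (Filter.Germ.coeRingHom (φ : Filter α))
    Quot.mk_surjective p
  have heval : ∀ u : α → ℝ, (P.map (Filter.Germ.coeRingHom (φ : Filter α))).eval
      (u : Filter.Germ (φ : Filter α) ℝ) =
      ((fun k => (P.map (Pi.evalRingHom _ k)).eval (u k) : α → ℝ) : Filter.Germ _ ℝ) := by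
    intro u
    have h1 : (fun k => (P.map (Pi.evalRingHom (fun _ : α => ℝ) k)).eval (u k)) = P.eval u := by
      funext k
      rw [eval_map]
      exact (hom_eval₂ P (RingHom.id _) (Pi.evalRingHom (fun _ : α => ℝ) k) u).symm
    rw [h1, eval_map]
    exact (hom_eval₂ P (RingHom.id _) (Filter.Germ.coeRingHom (φ : Filter α)) u).symm
  induction a using Filter.Germ.inductionOn with | _ u
  induction b using Filter.Germ.inductionOn with | _ v
  rw [heval, heval, ← Filter.Germ.coe_mul] at h
  have h := Filter.Germ.coe_le.1 h
  have hroot : ∀ k, ∃ c : ℝ, (P.map (Pi.evalRingHom (fun _ : α => ℝ) k)).eval (u k) *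
      (P.map (Pi.evalRingHom (fun _ : α => ℝ) k)).eval (v k) ≤ 0 →
      c ∈ Set.uIcc (u k) (v k) ∧ (P.map (Pi.evalRingHom (fun _ : α => ℝ) k)).eval c = 0 := by
    intro k
    by_cases hk : (P.map (Pi.evalRingHom (fun _ : α => ℝ) k)).eval (u k) *
      (P.map (Pi.evalRingHom (fun _ : α => ℝ) k)).eval (v k) ≤ 0
    · obtain ⟨c, hc, hc0⟩ := intermediate_value_uIcc (a := u k) (b := v k)
        (P.map (Pi.evalRingHom (fun _ : α => ℝ) k)).continuousOn
        (show (0 : ℝ) ∈ _ from by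
          rw [Set.mem_uIcc]
          rcases mul_nonpos_iff.1 hk with h | h
          · exact Or.inr h.symm
          · exact Or.inl h)
      exact ⟨c, fun _ => ⟨hc, hc0⟩⟩
    · exact ⟨0, fun h => absurd h hk⟩
  choose c hc using hroot
  refine ⟨(c : Filter.Germ _ ℝ), ?_, ?_⟩
  · rw [Set.uIcc, Set.mem_Icc, Filter.Germ.min_def, Filter.Germ.max_def, Filter.Germ.map₂_coe,
      Filter.Germ.map₂_coe, Filter.Germ.coe_le, Filter.Germ.coe_le]
    exact ⟨h.mono fun k hk => (hc k hk).1.1, h.mono fun k hk => (hc k hk).1.2⟩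
  · rw [heval]
    exact Filter.Germ.coe_eq.2 (h.mono fun k hk => (hc k hk).2)

end HenselianResidue

/-- The elements of an ordered field that are bounded by a power of `w` form a convex valuation ring. -/
theorem exists_valuationSubring_bounded_by_pow {K : Type*} [Field K] [LinearOrder K]
    [IsStrictOrderedRing K] (w : K) (hw : 2 ≤ w) : ∃ A : ValuationSubring K,
      (∀ a, a ∈ A ↔ ∃ N : ℕ, |a| ≤ w ^ N) ∧
      (∀ x y : K, |x| ≤ |y| → A.valuation x ≤ A.valuation y) ∧
      (∀ a, A.valuation a < 1 ↔ ∀ N : ℕ, |a| < (w ^ N)⁻¹) := by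
  have hw0 : 0 < w := by linarith
  have hw1 : 1 ≤ w := by linarith
  let R : Subring K :=
    { carrier := {a | ∃ N : ℕ, |a| ≤ w ^ N}
      mul_mem' := by
        rintro a b ⟨M, hM⟩ ⟨N, hN⟩
        exact ⟨M + N, by rw [abs_mul, pow_add]; gcongr⟩
      one_mem' := ⟨0, by simp⟩
      add_mem' := by
        rintro a b ⟨M, hM⟩ ⟨N, hN⟩
        refine ⟨M + N + 1, (abs_add_le a b).trans ?_⟩
        have h1 : w ^ M ≤ w ^ (M + N) := pow_le_pow_right₀ hw1 (by omega)
        have h2 : w ^ N ≤ w ^ (M + N) := pow_le_pow_right₀ hw1 (by omega)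
        have h3 : 0 < w ^ (M + N) := by positivity
        rw [pow_succ]
        nlinarith
      zero_mem' := ⟨0, by simp⟩
      neg_mem' := by
        rintro a ⟨N, hN⟩
        exact ⟨N, by rwa [abs_neg]⟩ }
  have hmem : ∀ x : K, |x| ≤ 1 → x ∈ R := fun x hx => ⟨0, by simpa using hx⟩
  let A := ValuationSubring.ofSubring R (by
    intro x
    rcases le_total |x| 1 with h | h
    · exact Or.inl (hmem x h)
    · exact Or.inr (hmem _ (by rw [abs_inv]; exact inv_le_one_of_one_le₀ h)))
  have hA : ∀ a, a ∈ A ↔ ∃ N : ℕ, |a| ≤ w ^ N := fun a => Iff.rfl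
  refine ⟨A, hA, fun x y hxy => ?_, fun a => ?_⟩
  · rw [A.valuation_le_iff]
    rcases eq_or_ne y 0 with rfl | hy
    · have : x = 0 := by simpa using hxy
      exact ⟨0, by simp [this]⟩
    · refine ⟨⟨x / y, hmem _ ?_⟩, div_mul_cancel₀ x hy⟩
      rw [abs_div]
      exact div_le_one_of_le₀ hxy (abs_nonneg y)
  · rcases eq_or_ne a 0 with rfl | ha
    · simp [hw0]
    · have h0 : 0 < A.valuation a := by simpa [zero_lt_iff] using ha
      rw [← one_lt_inv₀ h0, ← map_inv₀, ← not_le, A.valuation_le_one_iff, hA]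
      push Not
      refine forall_congr' fun N => ?_
      rw [abs_inv]
      exact lt_inv_comm₀ (by positivity) (abs_pos.2 ha)

/-- A global Łojasiewicz inequality: on a basic closed semialgebraic set `{g ≥ 0}`, the value of
`|r|` at `x` is at least a fixed power of `w⁻¹`, if `x` is bounded by `w` and is at distance
at least `w⁻¹` from the zeros of `r` in that set. -/
theorem exists_pow_inv_le_abs_eval {σ ι : Type*} [Finite σ] [Finite ι] (g : ι → MvPolynomial σ ℝ)
    (r : MvPolynomial σ ℝ) :
    ∃ N : ℕ, ∀ (x : σ → ℝ) (w : ℝ), 2 ≤ w → (∀ j, |x j| ≤ w) →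
      (∀ i, 0 ≤ MvPolynomial.eval x (g i)) →
      (∀ y : σ → ℝ, (∀ i, 0 ≤ MvPolynomial.eval y (g i)) → MvPolynomial.eval y r = 0 →
        ∃ j, w⁻¹ ≤ |x j - y j|) →
      (w ^ N)⁻¹ ≤ |MvPolynomial.eval x r| := by
  by_contra! hcon
  choose x w hw hxw hgx hsep hlt using hcon
  let φ := Filter.hyperfilter ℕ
  let K := Filter.Germ (φ : Filter ℕ) ℝ
  let C : ℝ →+* K := (Filter.Germ.coeRingHom (φ : Filter ℕ)).comp (Pi.constRingHom ℕ ℝ)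
  have heval : ∀ (u : σ → ℕ → ℝ) (p : MvPolynomial σ ℝ),
      MvPolynomial.eval₂ C (fun j => (u j : K)) p =
        ((fun k => MvPolynomial.eval (fun j => u j k) p : ℕ → ℝ) : K) := by
    intro u p
    have h1 : (fun k => MvPolynomial.eval (fun j => u j k) p) =
        MvPolynomial.eval₂ (Pi.constRingHom ℕ ℝ) u p := by
      funext k
      exact (MvPolynomial.hom_eval₂ p (Pi.constRingHom ℕ ℝ)
        (Pi.evalRingHom (fun _ : ℕ => ℝ) k) u).symm
    rw [h1]
    exact (MvPolynomial.hom_eval₂ p (Pi.constRingHom ℕ ℝ)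
      (Filter.Germ.coeRingHom (φ : Filter ℕ)) u).symm
  let W : K := (w : ℕ → ℝ)
  have hW : 2 ≤ W := Filter.Germ.coe_le.2 (Filter.Eventually.of_forall hw)
  obtain ⟨A, hAmem, hAmono, hAlt⟩ := exists_valuationSubring_bounded_by_pow W hW
  have := henselianLocalRing_of_intermediate_value A hAmono
    (exists_mem_uIcc_eval_eq_zero_of_germ φ)
  have hCA : ∀ c : ℝ, C c ∈ A := by
    intro c
    obtain ⟨N, hN⟩ := pow_unbounded_of_one_lt |c| (one_lt_two (α := ℝ))
    refine (hAmem _).2 ⟨N, ?_⟩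
    refine Filter.Germ.coe_le.2 (Filter.Eventually.of_forall fun k => ?_)
    exact hN.le.trans (pow_le_pow_left₀ zero_le_two (hw k) N)
  obtain ⟨F, hCF, hFA, hF⟩ := exists_coefficient_subfield A C.fieldRange (by
    rintro _ ⟨c, rfl⟩
    exact hCA c)
  let X : σ → K := fun j => ((fun k => x k j : ℕ → ℝ) : K)
  have hXA : ∀ j, X j ∈ A := fun j => (hAmem _).2 ⟨1, by
    rw [pow_one]
    exact Filter.Germ.coe_le.2 (Filter.Eventually.of_forall fun k => hxw k j)⟩
  choose Y hYF hXY using fun j => hF (X j) (hXA j)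
  have hvalF : ∀ p, MvPolynomial.eval₂ C Y p ∈ F := fun p =>
    MvPolynomial.eval₂_mem (fun i _ => hCF ⟨_, rfl⟩) hYF
  have hFzero : ∀ f ∈ F, A.valuation f < 1 → f = 0 := by
    intro f hf hf1
    by_contra hne
    have h1 := (A.valuation_le_one_iff _).2 (hFA _ (F.inv_mem hf))
    rw [map_inv₀] at h1
    have h0 : 0 < A.valuation f := by simpa [zero_lt_iff] using hne
    exact absurd hf1 (not_lt.2 ((inv_le_one₀ h0).1 h1))
  have hdiff : ∀ p, A.valuation (MvPolynomial.eval₂ C X p - MvPolynomial.eval₂ C Y p) < 1 := by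
    intro p
    let C' : ℝ →+* A := C.codRestrict A.toSubring hCA
    let X' : σ → A := fun j => ⟨X j, hXA j⟩
    let Y' : σ → A := fun j => ⟨Y j, hFA _ (hYF j)⟩
    have h1 : MvPolynomial.eval₂ C X p = (MvPolynomial.eval₂ C' X' p : A) :=
      (MvPolynomial.hom_eval₂ p C' A.subtype X').symm
    have h2 : MvPolynomial.eval₂ C Y p = (MvPolynomial.eval₂ C' Y' p : A) :=
      (MvPolynomial.hom_eval₂ p C' A.subtype Y').symm
    have h3 : (fun j => IsLocalRing.residue A (X' j)) = fun j => IsLocalRing.residue A (Y' j) := by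
      funext j
      rw [← sub_eq_zero, ← map_sub, IsLocalRing.residue_eq_zero_iff, A.valuation_lt_one_iff]
      exact hXY j
    have h4 : MvPolynomial.eval₂ C' X' p - MvPolynomial.eval₂ C' Y' p ∈
        IsLocalRing.maximalIdeal A := by
      rw [← IsLocalRing.residue_eq_zero_iff, map_sub, MvPolynomial.hom_eval₂,
        MvPolynomial.hom_eval₂, h3, sub_self]
    rw [h1, h2]
    exact (A.valuation_lt_one_iff _).1 h4
  have hgY : ∀ i, 0 ≤ MvPolynomial.eval₂ C Y (g i) := by
    intro i
    by_contra! hneg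
    have hX0 : 0 ≤ MvPolynomial.eval₂ C X (g i) := by
      rw [heval]
      exact Filter.Germ.coe_le.2 (Filter.Eventually.of_forall fun k => hgx k i)
    refine hneg.ne (hFzero _ (hvalF _) ((hAmono _ _ ?_).trans_lt (hdiff (g i))))
    rw [abs_of_neg hneg, abs_of_nonneg (by linarith)]
    linarith
  have hrX : A.valuation (MvPolynomial.eval₂ C X r) < 1 := by
    rw [hAlt]
    intro N
    rw [heval]
    refine Filter.Germ.coe_lt.2 ?_
    have hev : ∀ᶠ k in (φ : Filter ℕ), N ≤ k :=
      Nat.hyperfilter_le_atTop (Filter.eventually_ge_atTop N)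
    filter_upwards [hev] with k hk
    refine (hlt k).trans_le ?_
    have h1 : 1 ≤ w k := one_le_two.trans (hw k)
    exact inv_anti₀ (pow_pos (one_pos.trans_le h1) N) (pow_le_pow_right₀ h1 hk)
  have hrY : MvPolynomial.eval₂ C Y r = 0 := by
    refine hFzero _ (hvalF r) ?_
    have := A.valuation.map_sub_lt hrX (hdiff r)
    rwa [sub_sub_cancel] at this
  choose y hy using fun j => Quot.mk_surjective (Y j)
  obtain rfl : (fun j => (y j : K)) = Y := funext hy
  have e1 : ∀ᶠ k in (φ : Filter ℕ), ∀ i, 0 ≤ MvPolynomial.eval (fun j => y j k) (g i) := by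
    rw [Filter.eventually_all]
    intro i
    have := hgY i
    rw [heval] at this
    exact Filter.Germ.coe_le.1 this
  have e2 : ∀ᶠ k in (φ : Filter ℕ), MvPolynomial.eval (fun j => y j k) r = 0 := by
    rw [heval] at hrY
    exact Filter.Germ.coe_eq.1 hrY
  have e3 : ∀ᶠ k in (φ : Filter ℕ), ∀ j, |x k j - y j k| < (w k)⁻¹ := by
    rw [Filter.eventually_all]
    intro j
    have := (hAlt _).1 (hXY j) 1
    rw [pow_one] at this
    exact Filter.Germ.coe_lt.1 this
  obtain ⟨k, h1, h2, h3⟩ := (e1.and (e2.and e3)).exists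
  obtain ⟨j, hj⟩ := hsep k _ h1 h2
  exact absurd (h3 j) (not_lt.2 hj)

theorem stmt_3 {n m : ℕ}
    (G H : EuclideanSpace ℝ (Fin n) → Fin m → ℝ)
    (hGpoly : ∀ i, ∃ p : MvPolynomial (Fin n) ℝ, ∀ x, G x i = MvPolynomial.eval (fun j => x j) p)
    (hHpoly : ∀ i, ∃ p : MvPolynomial (Fin n) ℝ, ∀ x, H x i = MvPolynomial.eval (fun j => x j) p)
    (S : Set (EuclideanSpace ℝ (Fin n)))
    (hS : S = {x | (∀ i, 0 ≤ G x i) ∧ (∀ i, 0 ≤ H x i) ∧ ∑ i, G x i * H x i = 0})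
    (Sσ : ℝ → Set (EuclideanSpace ℝ (Fin n)))
    (hSσ : ∀ σ, Sσ σ = {x | (∀ i, 0 ≤ G x i) ∧ (∀ i, 0 ≤ H x i) ∧ ∑ i, G x i * H x i ≤ σ})
    (hSne : S.Nonempty) :
    ∃ β > (0 : ℝ), ∃ τ > (0 : ℝ), ∃ γ : ℝ, 0 ≤ γ ∧
      ∀ σ > (0 : ℝ), ∀ x ∈ Sσ σ,
        Metric.infDist x S ≤ β * (1 + ‖x‖) ^ γ * σ ^ τ := by
  choose p hp using hGpoly
  choose q hq using hHpoly
  obtain ⟨N, hN⟩ := exists_pow_inv_le_abs_eval (Sum.elim p q) (∑ i, p i * q i)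
  obtain ⟨x₀, hx₀⟩ := hSne
  refine ⟨n + 1 + 2 * (1 + ‖x₀‖), by positivity, ((N + 1 : ℕ) : ℝ)⁻¹, by positivity, 2, by norm_num,
    fun σ hσ x hx => ?_⟩
  set d := Metric.infDist x S with hd
  rcases (Metric.infDist_nonneg (x := x) (s := S)).eq_or_lt with h0 | hpos
  · rw [hd, ← h0]
    positivity
  rw [← hd] at hpos
  rw [hSσ] at hx
  obtain ⟨hG, hH, hGH⟩ := hx
  set w : ℝ := 2 + ‖x‖ + (n + 1) / d with hwdef
  have hfrac : 0 < (n + 1) / d := by positivity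
  have hw2 : 2 ≤ w := by linarith [norm_nonneg x]
  have hw0 : 0 < w := by linarith
  have hr : (w ^ N)⁻¹ ≤ |MvPolynomial.eval (fun j => x j) (∑ i, p i * q i)| := by
    refine hN _ w hw2 (fun j => ?_) ?_ ?_
    · have := PiLp.norm_apply_le x j
      rw [Real.norm_eq_abs] at this
      linarith
    · rintro (i | i)
      · exact hp i x ▸ hG i
      · exact hq i x ▸ hH i
    · intro y hy hy0
      have hyS : WithLp.toLp 2 y ∈ S := by
        rw [hS]
        refine ⟨fun i => ?_, fun i => ?_, ?_⟩
        · rw [hp]; exact hy (Sum.inl i)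
        · rw [hq]; exact hy (Sum.inr i)
        · simp only [hp, hq]
          simpa using hy0
      by_contra! hlt
      have h1 : d ≤ ‖x - WithLp.toLp 2 y‖ := by
        rw [← dist_eq_norm]
        exact Metric.infDist_le_dist_of_mem hyS
      have h2 : ‖x - WithLp.toLp 2 y‖ ≤ ∑ j, |x j - y j| := by
        rw [EuclideanSpace.norm_eq]
        refine Real.sqrt_le_iff.2 ⟨Finset.sum_nonneg fun j _ => abs_nonneg _, ?_⟩
        exact Finset.sum_sq_le_sq_sum_of_nonneg fun j _ => abs_nonneg _
      have h3 : ∑ j, |x j - y j| ≤ n * w⁻¹ := by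
        refine (Finset.sum_le_sum fun j _ => (hlt j).le).trans ?_
        simp
      have h4 : d * w ≤ n := by
        have := mul_le_mul_of_nonneg_right (h1.trans (h2.trans h3)) hw0.le
        rwa [mul_assoc, inv_mul_cancel₀ hw0.ne', mul_one] at this
      have h5 : d * ((n + 1) / d) = n + 1 := mul_div_cancel₀ _ hpos.ne'
      have h6 : d * w = d * (2 + ‖x‖) + (n + 1) := by rw [hwdef, mul_add, h5]
      have : 0 ≤ d * (2 + ‖x‖) := by positivity
      linarith
  have hreval : MvPolynomial.eval (fun j => x j) (∑ i, p i * q i) = ∑ i, G x i * H x i := by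
    simp [hp, hq]
  rw [hreval, abs_of_nonneg (Finset.sum_nonneg fun i _ => mul_nonneg (hG i) (hH i))] at hr
  have hwσ : w⁻¹ ≤ σ ^ ((N + 1 : ℕ) : ℝ)⁻¹ := by
    rw [Real.le_rpow_inv_iff_of_pos (by positivity) hσ.le (by positivity), Real.rpow_natCast]
    refine le_trans ?_ (hr.trans hGH)
    rw [inv_pow]
    exact inv_anti₀ (by positivity) (pow_le_pow_right₀ (by linarith) (Nat.le_succ N))
  have hdx : d ≤ (1 + ‖x₀‖) * (1 + ‖x‖) := by
    have h1 : d ≤ ‖x - x₀‖ := by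
      rw [← dist_eq_norm]
      exact Metric.infDist_le_dist_of_mem hx₀
    have := norm_sub_le x x₀
    nlinarith [mul_nonneg (norm_nonneg x₀) (norm_nonneg x)]
  have hdw : d * w ≤ (n + 1 + 2 * (1 + ‖x₀‖)) * (1 + ‖x‖) ^ 2 := by
    have h5 : d * ((n + 1) / d) = n + 1 := mul_div_cancel₀ _ hpos.ne'
    have h6 : d * w = d * (2 + ‖x‖) + (n + 1) := by rw [hwdef, mul_add, h5]
    have h7 : d * (2 + ‖x‖) ≤ (1 + ‖x₀‖) * (1 + ‖x‖) * (2 * (1 + ‖x‖)) := by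
      gcongr
      linarith [norm_nonneg x]
    have h8 : 1 ≤ (1 + ‖x‖) ^ 2 := one_le_pow₀ (by linarith [norm_nonneg x])
    have h9 : (n + 1 : ℝ) * 1 ≤ (n + 1) * (1 + ‖x‖) ^ 2 := by gcongr
    nlinarith
  rw [Real.rpow_two]
  calc d = d * w * w⁻¹ := by rw [mul_assoc, mul_inv_cancel₀ hw0.ne', mul_one]
    _ ≤ _ := by gcongr
end

section
/- Let A, C ∈ ℝ^{m×n} with C of full row rank m, let b, d ∈ ℝ^m, and set M = A Cᵀ (C Cᵀ)⁻¹ ∈ ℝ^{m×m}. Suppose M is row sufficient and the system is feasible, i.e., there exists x₀ ∈ ℝ^n with Ax₀ − b ≥ 0 and Cx₀ − d ≥ 0. Then the vertical linear complementarity system is solvable: there exists x ∈ ℝ^n with Ax − b ≥ 0, Cx − d ≥ 0, and (Ax − b)ᵀ(Cx − d) = 0. -/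
open scoped BigOperators
open Matrix

open Filter Topology

/-- **Farkas' lemma** for finitely many linear functionals. -/
lemma exists_nonneg_sum_smul_eq {V ι : Type*} [AddCommGroup V] [Module ℝ V] [DecidableEq ι]
    (s : Finset ι) (f : ι → V →ₗ[ℝ] ℝ) (g : V →ₗ[ℝ] ℝ)
    (h : ∀ x, (∀ i ∈ s, 0 ≤ f i x) → 0 ≤ g x) :
    ∃ c : ι → ℝ, (∀ i, 0 ≤ c i) ∧ (∀ i ∉ s, c i = 0) ∧ ∀ x, g x = ∑ i ∈ s, c i * f i x := by
  induction s using Finset.induction_on generalizing f g with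
  | empty =>
    refine ⟨0, by simp, by simp, fun x => ?_⟩
    have h1 := h x (by simp)
    have h2 := h (-x) (by simp)
    rw [map_neg] at h2
    simp only [Finset.sum_empty]
    linarith
  | insert a s ha ih =>
    by_cases hg : ∀ x, (∀ i ∈ s, 0 ≤ f i x) → 0 ≤ g x
    · obtain ⟨c, hc, hcs, hgc⟩ := ih f g hg
      refine ⟨c, hc, fun i hi => hcs i fun h' => hi (Finset.mem_insert_of_mem h'), fun x => ?_⟩
      rw [Finset.sum_insert ha, hcs a ha, hgc x]
      ring
    · push Not at hg
      obtain ⟨y, hy, hgy⟩ := hg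
      have hay : f a y < 0 := by
        by_contra! hay
        refine absurd (h y fun i hi => ?_) (not_le.2 hgy)
        rcases Finset.mem_insert.1 hi with rfl | hi
        · exact hay
        · exact hy i hi
      -- the projection along `y` onto the kernel of `f a`
      let p : V →ₗ[ℝ] V := LinearMap.id - ((f a y)⁻¹ • f a).smulRight y
      have hp : ∀ (l : V →ₗ[ℝ] ℝ) x, l (p x) = l x - (f a y)⁻¹ * f a x * l y := fun l x => by
        simp [p]
      obtain ⟨c, hc, hcs, hgc⟩ := ih (fun i => f i ∘ₗ p) (g ∘ₗ p) fun x hx => by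
        refine h (p x) fun i hi => ?_
        rcases Finset.mem_insert.1 hi with rfl | hi
        · rw [hp, mul_right_comm, inv_mul_cancel₀ hay.ne, one_mul, sub_self]
        · exact hx i hi
      have hsum : 0 ≤ ∑ i ∈ s, c i * f i y :=
        Finset.sum_nonneg fun i hi => mul_nonneg (hc i) (hy i hi)
      refine ⟨Function.update c a ((g y - ∑ i ∈ s, c i * f i y) * (f a y)⁻¹),
        fun i => ?_, fun i hi => ?_, fun x => ?_⟩
      · rcases eq_or_ne i a with rfl | hi
        · rw [Function.update_self]
          exact mul_nonneg_of_nonpos_of_nonpos (by linarith) (inv_nonpos.2 hay.le)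
        · rw [Function.update_of_ne hi]
          exact hc i
      · rw [Finset.mem_insert, not_or] at hi
        rw [Function.update_of_ne hi.1]
        exact hcs i hi.2
      · have hx := hgc x
        simp only [LinearMap.comp_apply, hp, mul_sub, Finset.sum_sub_distrib] at hx
        have hupd : ∀ r, ∑ i ∈ s, Function.update c a r i * f i x = ∑ i ∈ s, c i * f i x :=
          fun r => Finset.sum_congr rfl fun i hi => by
            rw [Function.update_of_ne (ne_of_mem_of_not_mem hi ha)]
        rw [Finset.sum_insert ha, Function.update_self, hupd]
        have hfac : ∑ i ∈ s, c i * ((f a y)⁻¹ * f a x * f i y) =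
            (f a y)⁻¹ * f a x * ∑ i ∈ s, c i * f i y := by
          rw [Finset.mul_sum]
          exact Finset.sum_congr rfl fun i _ => by ring
        rw [hfac] at hx
        linear_combination hx

lemma eventually_forall_nonneg_add_mul {ι : Type*} [Finite ι] {a p : ι → ℝ}
    (ha : ∀ i, 0 ≤ a i) (hp : ∀ i, a i = 0 → 0 ≤ p i) :
    ∀ᶠ t : ℝ in 𝓝[>] 0, ∀ i, 0 ≤ a i + t * p i := by
  refine eventually_all.2 fun i => ?_
  rcases (ha i).eq_or_lt with h | h
  · filter_upwards [self_mem_nhdsWithin] with t ht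
    rw [← h, zero_add]
    exact mul_nonneg (le_of_lt ht) (hp i h.symm)
  · have hc : Tendsto (fun t : ℝ => a i + t * p i) (𝓝[>] 0) (𝓝 (a i + 0 * p i)) :=
      (Continuous.tendsto (by fun_prop) 0).mono_left nhdsWithin_le_nhds
    rw [zero_mul, add_zero] at hc
    exact (hc.eventually (lt_mem_nhds h)).mono fun t ht => ht.le

lemma nonneg_of_eventually_nonneg_mul_add_sq_mul {a b : ℝ}
    (h : ∀ᶠ t : ℝ in 𝓝[>] 0, 0 ≤ t * a + t ^ 2 * b) : 0 ≤ a := by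
  have hc : Tendsto (fun t : ℝ => a + t * b) (𝓝[>] 0) (𝓝 (a + 0 * b)) :=
    (Continuous.tendsto (by fun_prop) 0).mono_left nhdsWithin_le_nhds
  rw [zero_mul, add_zero] at hc
  refine ge_of_tendsto hc ?_
  filter_upwards [h, self_mem_nhdsWithin] with t ht ht0
  have ht0 : 0 < t := ht0
  refine (mul_nonneg_iff_of_pos_left ht0).1 ?_
  linarith

section LCP

variable {ι : Type*} [Fintype ι]

/-- The feasible set of the linear complementarity problem `LCP(q, M)`. -/
def lcpFeasible (M : Matrix ι ι ℝ) (q : ι → ℝ) : Set (ι → ℝ) :=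
  {z | (∀ i, 0 ≤ z i) ∧ ∀ i, 0 ≤ (M *ᵥ z + q) i}

/-- The quadratic objective of the linear complementarity problem `LCP(q, M)`. -/
def lcpObjective (M : Matrix ι ι ℝ) (q z : ι → ℝ) : ℝ := z ⬝ᵥ (M *ᵥ z + q)

variable {M : Matrix ι ι ℝ} {q : ι → ℝ}

lemma lcpObjective_nonneg {z : ι → ℝ} (hz : z ∈ lcpFeasible M q) : 0 ≤ lcpObjective M q z :=
  Finset.sum_nonneg fun i _ => mul_nonneg (hz.1 i) (hz.2 i)

lemma lcpObjective_add_smul (z v : ι → ℝ) (t : ℝ) :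
    lcpObjective M q (z + t • v) = lcpObjective M q z +
      t * (z ⬝ᵥ M *ᵥ v + v ⬝ᵥ (M *ᵥ z + q)) + t ^ 2 * (v ⬝ᵥ M *ᵥ v) := by
  simp only [lcpObjective, mulVec_add, mulVec_smul, dotProduct_add, add_dotProduct,
    smul_dotProduct, dotProduct_smul, smul_eq_mul]
  ring

lemma continuous_lcpObjective : Continuous (lcpObjective M q) := by
  unfold lcpObjective
  fun_prop

lemma isClosed_lcpFeasible : IsClosed (lcpFeasible M q) := by
  simp only [lcpFeasible, Set.ofPred_and, Set.ofPred_forall]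
  refine (isClosed_iInter fun i => isClosed_le continuous_const (by fun_prop)).inter
    (isClosed_iInter fun i => isClosed_le continuous_const ?_)
  exact (continuous_apply i).comp (by fun_prop)

lemma add_smul_mem_lcpFeasible_iff {z v : ι → ℝ} {t : ℝ} :
    z + t • v ∈ lcpFeasible M q ↔
      (∀ i, 0 ≤ z i + t * v i) ∧ ∀ i, 0 ≤ (M *ᵥ z + q) i + t * (M *ᵥ v) i := by
  simp only [lcpFeasible, Set.mem_ofPred_eq, mulVec_add, mulVec_smul, Pi.add_apply, Pi.smul_apply,
    smul_eq_mul, add_right_comm]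

lemma eventually_add_smul_mem_lcpFeasible {z v : ι → ℝ} (hz : z ∈ lcpFeasible M q)
    (h₁ : ∀ i, z i = 0 → 0 ≤ v i) (h₂ : ∀ i, (M *ᵥ z + q) i = 0 → 0 ≤ (M *ᵥ v) i) :
    ∀ᶠ t : ℝ in 𝓝[>] 0, z + t • v ∈ lcpFeasible M q := by
  filter_upwards [eventually_forall_nonneg_add_mul hz.1 h₁,
    eventually_forall_nonneg_add_mul hz.2 h₂] with t h h'
  exact add_smul_mem_lcpFeasible_iff.2 ⟨h, h'⟩

lemma sq_norm_le_dotProduct_self (z : ι → ℝ) : ‖z‖ ^ 2 ≤ z ⬝ᵥ z := by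
  have h0 : 0 ≤ z ⬝ᵥ z := Finset.sum_nonneg fun i _ => mul_self_nonneg (z i)
  refine (Real.le_sqrt (norm_nonneg z) h0).1 ((pi_norm_le_iff_of_nonneg (Real.sqrt_nonneg _)).2
    fun i => Real.le_sqrt_of_sq_le ?_)
  rw [Real.norm_eq_abs, sq_abs, sq]
  exact Finset.single_le_sum (f := fun i => z i * z i) (fun i _ => mul_self_nonneg (z i))
    (Finset.mem_univ i)

lemma exists_isMinOn_lcpObjective_add_mul {z₀ : ι → ℝ} (hz₀ : z₀ ∈ lcpFeasible M q)
    {ε : ℝ} (hε : 0 < ε) :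
    ∃ z ∈ lcpFeasible M q,
      IsMinOn (fun z => lcpObjective M q z + ε * (z ⬝ᵥ z)) (lcpFeasible M q) z := by
  refine ContinuousOn.exists_isMinOn' (Continuous.continuousOn ?_) isClosed_lcpFeasible hz₀ ?_
  · exact continuous_lcpObjective.add (by fun_prop)
  · rw [eventually_inf_principal]
    have h : Tendsto (fun z : ι → ℝ => ε * ‖z‖ ^ 2) (cocompact _) atTop :=
      ((tendsto_pow_atTop two_ne_zero).comp tendsto_norm_cocompact_atTop).const_mul_atTop hε
    filter_upwards [h.eventually_ge_atTop (lcpObjective M q z₀ + ε * (z₀ ⬝ᵥ z₀))] with z hz hzP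
    have := mul_le_mul_of_nonneg_left (sq_norm_le_dotProduct_self z) hε.le
    linarith [lcpObjective_nonneg hzP]

/-- Minimizers of the regularized objective admit no recession direction `v` of zero curvature
along which one could move back towards the origin. -/
lemma not_isMinOn_lcpObjective_add_mul {z v : ι → ℝ} {ε : ℝ} (hε : 0 < ε)
    (hz : z ∈ lcpFeasible M q) (hv : ∀ i, 0 ≤ v i) (hMv : ∀ i, 0 ≤ (M *ᵥ v) i)
    (hvv : v ⬝ᵥ M *ᵥ v = 0) (hzv : ∀ i, 0 < v i → 0 < z i)
    (hwv : ∀ i, 0 < (M *ᵥ v) i → 0 < (M *ᵥ z + q) i) (hpos : 0 < v ⬝ᵥ z) :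
    ¬ IsMinOn (fun z => lcpObjective M q z + ε * (z ⬝ᵥ z)) (lcpFeasible M q) z := by
  intro hmin
  have hD : 0 ≤ z ⬝ᵥ M *ᵥ v + v ⬝ᵥ (M *ᵥ z + q) :=
    add_nonneg (Finset.sum_nonneg fun i _ => mul_nonneg (hz.1 i) (hMv i))
      (Finset.sum_nonneg fun i _ => mul_nonneg (hv i) (hz.2 i))
  have hfeas := eventually_add_smul_mem_lcpFeasible (v := -v) hz
    (fun i hi => by
      have : ¬ 0 < v i := fun h => (hzv i h).ne' hi
      simpa using this)
    (fun i hi => by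
      have : ¬ 0 < (M *ᵥ v) i := fun h => (hwv i h).ne' hi
      simpa [mulVec_neg] using this)
  have := nonneg_of_eventually_nonneg_mul_add_sq_mul
    (a := -(z ⬝ᵥ M *ᵥ v + v ⬝ᵥ (M *ᵥ z + q)) - 2 * ε * (v ⬝ᵥ z)) (b := ε * (v ⬝ᵥ v)) <| by
    filter_upwards [hfeas] with t ht
    have h := hmin ht
    simp only [Set.mem_ofPred_eq, lcpObjective_add_smul, mulVec_neg, dotProduct_neg, neg_dotProduct,
      hvv, add_dotProduct, dotProduct_add, smul_dotProduct, dotProduct_smul, smul_eq_mul,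
      dotProduct_comm z v] at h ⊢
    linarith
  nlinarith [mul_pos hε hpos]

/-- **Frank–Wolfe**: the objective of a feasible linear complementarity problem attains its
minimum. -/
lemma exists_isMinOn_lcpObjective {z₀ : ι → ℝ} (hz₀ : z₀ ∈ lcpFeasible M q) :
    ∃ z ∈ lcpFeasible M q, IsMinOn (lcpObjective M q) (lcpFeasible M q) z := by
  have hε : ∀ k : ℕ, (0 : ℝ) < 1 / ((k : ℝ) + 1) := fun k => Nat.one_div_pos_of_nat
  choose z hzP hzmin using fun k => exists_isMinOn_lcpObjective_add_mul hz₀ (hε k)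
  let U : Ultrafilter ℕ := hyperfilter ℕ
  have hεU : Tendsto (fun k : ℕ => 1 / ((k : ℝ) + 1)) U (𝓝 0) :=
    tendsto_one_div_add_atTop_nhds_zero_nat.mono_left Nat.hyperfilter_le_atTop
  have hle : ∀ y ∈ lcpFeasible M q, ∀ k,
      lcpObjective M q (z k) ≤ lcpObjective M q y + 1 / ((k : ℝ) + 1) * (y ⬝ᵥ y) := by
    intro y hy k
    have h := hzmin k hy
    have h0 : 0 ≤ 1 / ((k : ℝ) + 1) * (z k ⬝ᵥ z k) :=
      mul_nonneg (hε k).le (Finset.sum_nonneg fun i _ => mul_self_nonneg _)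
    simp only [Set.mem_ofPred_eq] at h
    linarith
  by_cases hb : ∃ R : ℝ, ∀ᶠ k in U, ‖z k‖ ≤ R
  · obtain ⟨R, hR⟩ := hb
    obtain ⟨z', -, hz'⟩ := (isCompact_closedBall (0 : ι → ℝ) R).ultrafilter_le_nhds (U.map z)
      (by
        rw [le_principal_iff]
        change ∀ᶠ k in U, z k ∈ Metric.closedBall 0 R
        filter_upwards [hR] with k hk
        simpa using hk)
    have hz' : Tendsto z U (𝓝 z') := hz'
    refine ⟨z', isClosed_lcpFeasible.mem_of_tendsto hz' (Eventually.of_forall hzP), fun y hy => ?_⟩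
    refine le_of_tendsto_of_tendsto ((continuous_lcpObjective.tendsto z').comp hz') ?_
      (Eventually.of_forall (hle y hy))
    simpa using (hεU.mul_const (y ⬝ᵥ y)).const_add (lcpObjective M q y)
  · exfalso
    have hN : Tendsto (fun k => ‖z k‖) U atTop := by
      refine tendsto_atTop.2 fun R => ?_
      have : ¬ ∀ᶠ k in U, ‖z k‖ ≤ R := fun h => hb ⟨R, h⟩
      exact (Ultrafilter.eventually_not.2 this).mono fun k hk => (not_le.1 hk).le
    have hN0 : ∀ᶠ k in U, 0 < ‖z k‖ := hN.eventually_gt_atTop 0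
    have hNinv : Tendsto (fun k => ‖z k‖⁻¹) U (𝓝 0) := tendsto_inv_atTop_zero.comp hN
    obtain ⟨v, hv1, hv⟩ := (isCompact_sphere (0 : ι → ℝ) 1).ultrafilter_le_nhds
      (U.map fun k => ‖z k‖⁻¹ • z k) (by
        rw [le_principal_iff]
        change ∀ᶠ k in U, ‖z k‖⁻¹ • z k ∈ Metric.sphere 0 1
        filter_upwards [hN0] with k hk
        simp [norm_smul, hk.ne'])
    have hv : Tendsto (fun k => ‖z k‖⁻¹ • z k) U (𝓝 v) := hv
    have hw : Tendsto (fun k => ‖z k‖⁻¹ • (M *ᵥ z k + q)) U (𝓝 (M *ᵥ v)) := by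
      have h1 : Tendsto (fun k => M *ᵥ (‖z k‖⁻¹ • z k)) U (𝓝 (M *ᵥ v)) :=
        (Continuous.tendsto (f := fun x => M *ᵥ x) (by fun_prop) v).comp hv
      simpa [mulVec_smul, smul_add] using h1.add (hNinv.smul_const q)
    have hvi : ∀ i, Tendsto (fun k => ‖z k‖⁻¹ * z k i) U (𝓝 (v i)) := tendsto_pi_nhds.1 hv
    have hwi : ∀ i, Tendsto (fun k => ‖z k‖⁻¹ * (M *ᵥ z k + q) i) U (𝓝 ((M *ᵥ v) i)) :=
      tendsto_pi_nhds.1 hw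
    have hv0 : ∀ i, 0 ≤ v i := fun i => ge_of_tendsto' (hvi i) fun k =>
      mul_nonneg (inv_nonneg.2 (norm_nonneg _)) ((hzP k).1 i)
    have hMv0 : ∀ i, 0 ≤ (M *ᵥ v) i := fun i => ge_of_tendsto' (hwi i) fun k =>
      mul_nonneg (inv_nonneg.2 (norm_nonneg _)) ((hzP k).2 i)
    have hdot : Continuous fun p : (ι → ℝ) × (ι → ℝ) => p.1 ⬝ᵥ p.2 := by fun_prop
    have hvv : v ⬝ᵥ M *ᵥ v = 0 := by
      refine le_antisymm ?_ (Finset.sum_nonneg fun i _ => mul_nonneg (hv0 i) (hMv0 i))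
      have hlim := (hdot.tendsto (v, M *ᵥ v)).comp (hv.prodMk_nhds hw)
      have hbd : Tendsto (fun k => ‖z k‖⁻¹ * (‖z k‖⁻¹ *
          (lcpObjective M q z₀ + 1 / ((k : ℝ) + 1) * (z₀ ⬝ᵥ z₀)))) U (𝓝 0) := by
        simpa using hNinv.mul
          (hNinv.mul ((hεU.mul_const (z₀ ⬝ᵥ z₀)).const_add (lcpObjective M q z₀)))
      refine le_of_tendsto_of_tendsto' hlim hbd fun k => ?_
      simp only [Function.comp_apply, smul_dotProduct, dotProduct_smul, smul_eq_mul]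
      have := inv_nonneg.2 (norm_nonneg (z k))
      gcongr
      exact hle z₀ hz₀ k
    have hvpos : 0 < v ⬝ᵥ v := by
      have := sq_norm_le_dotProduct_self v
      rw [mem_sphere_zero_iff_norm.1 hv1] at this
      linarith
    have hpos : Tendsto (fun k => ‖z k‖⁻¹ * (v ⬝ᵥ z k)) U (𝓝 (v ⬝ᵥ v)) := by
      simpa [Function.comp_def] using
        (hdot.tendsto (v, v)).comp ((tendsto_const_nhds (x := v)).prodMk_nhds hv)
    have hev : ∀ (r : ℕ → ℝ) (l : ℝ), Tendsto (fun k => ‖z k‖⁻¹ * r k) U (𝓝 l) →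
        ∀ᶠ k in U, 0 < l → 0 < r k := fun r l h => by
      by_cases hl : 0 < l
      · filter_upwards [h.eventually (lt_mem_nhds hl)] with k hk _
        exact pos_of_mul_pos_right hk (inv_nonneg.2 (norm_nonneg _))
      · exact Eventually.of_forall fun k h => absurd h hl
    obtain ⟨k, h1, h2, h3⟩ := ((eventually_all.2 fun i => hev _ _ (hvi i)).and
      ((eventually_all.2 fun i => hev _ _ (hwi i)).and (hev _ _ hpos))).exists
    exact not_isMinOn_lcpObjective_add_mul (hε k) (hzP k) hv0 hMv0 hvv h1 h2 (h3 hvpos) (hzmin k)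

/-- Karush–Kuhn–Tucker conditions for the quadratic program attached to `LCP(q, M)`. -/
lemma exists_kkt_multiplier [DecidableEq ι] {z : ι → ℝ} (hz : z ∈ lcpFeasible M q)
    (hmin : IsMinOn (lcpObjective M q) (lcpFeasible M q) z) :
    ∃ l u : ι → ℝ, (∀ i, 0 ≤ l i) ∧ (∀ i, 0 ≤ u i) ∧ (∀ i, z i * l i = 0) ∧
      (∀ i, u i * (M *ᵥ z + q) i = 0) ∧ l + Mᵀ *ᵥ u = M *ᵥ z + q + Mᵀ *ᵥ z := by
  let f : ι ⊕ ι → (ι → ℝ) →ₗ[ℝ] ℝ :=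
    Sum.elim LinearMap.proj fun i => LinearMap.proj i ∘ₗ M.mulVecLin
  let s : Finset (ι ⊕ ι) := Finset.univ.filter fun j => Sum.elim z (M *ᵥ z + q) j = 0
  obtain ⟨c, hc, hcs, hg⟩ := exists_nonneg_sum_smul_eq s f
    (dotProductBilin ℝ ℝ (M *ᵥ z + q + Mᵀ *ᵥ z)) fun v hv => by
      have hfeas := eventually_add_smul_mem_lcpFeasible (v := v) hz
        (fun i hi => hv (Sum.inl i) (by simpa [s] using hi))
        (fun i hi => hv (Sum.inr i) (by simpa [s] using hi))
      have := nonneg_of_eventually_nonneg_mul_add_sq_mul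
        (a := z ⬝ᵥ M *ᵥ v + v ⬝ᵥ (M *ᵥ z + q)) (b := v ⬝ᵥ M *ᵥ v) <| by
        filter_upwards [hfeas] with t ht
        have h := hmin ht
        rw [Set.mem_ofPred_eq, lcpObjective_add_smul] at h
        linarith
      rw [dotProduct_mulVec, ← mulVec_transpose, dotProduct_comm v] at this
      simpa [add_dotProduct, add_comm, add_left_comm, add_assoc] using this
  refine ⟨fun i => c (Sum.inl i), fun i => c (Sum.inr i), fun i => hc _, fun i => hc _,
    fun i => ?_, fun i => ?_, dotProduct_eq _ _ fun v => ?_⟩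
  · beta_reduce
    by_cases h : z i = 0
    · rw [h, zero_mul]
    · rw [hcs (Sum.inl i) (by simpa [s] using h), mul_zero]
  · beta_reduce
    by_cases h : (M *ᵥ z + q) i = 0
    · rw [h, mul_zero]
    · rw [hcs (Sum.inr i) (by simpa [s] using h), zero_mul]
  · have hgv := hg v
    rw [Finset.sum_subset (Finset.subset_univ s) fun j _ hj => by rw [hcs j hj, zero_mul],
      Fintype.sum_sum_type] at hgv
    rw [add_dotProduct, mulVec_transpose, ← dotProduct_mulVec]
    exact hgv.symm

/-- A feasible linear complementarity problem with row sufficient matrix is solvable. -/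
lemma exists_lcpObjective_eq_zero
    (hM : ∀ z : ι → ℝ, (∀ i, z i * (Mᵀ *ᵥ z) i ≤ 0) → ∀ i, z i * (Mᵀ *ᵥ z) i = 0)
    {z₀ : ι → ℝ} (hz₀ : z₀ ∈ lcpFeasible M q) :
    ∃ z ∈ lcpFeasible M q, lcpObjective M q z = 0 := by
  classical
  obtain ⟨z, hz, hmin⟩ := exists_isMinOn_lcpObjective hz₀
  obtain ⟨l, u, hl, hu, hzl, huw, heq⟩ := exists_kkt_multiplier hz hmin
  have key : ∀ i, (z - u) i * (Mᵀ *ᵥ (z - u)) i = -(z i * (M *ᵥ z + q) i) - u i * l i := by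
    intro i
    have h := congrFun heq i
    have h1 := hzl i
    have h2 := huw i
    rw [mulVec_sub]
    simp only [Pi.add_apply, Pi.sub_apply] at h h2 ⊢
    linear_combination (u i - z i) * h + h1 + h2
  have hzw : ∀ i, 0 ≤ z i * (M *ᵥ z + q) i := fun i => mul_nonneg (hz.1 i) (hz.2 i)
  have hul : ∀ i, 0 ≤ u i * l i := fun i => mul_nonneg (hu i) (hl i)
  have hzero := hM (z - u) fun i => by
    rw [key]
    linarith [hzw i, hul i]
  refine ⟨z, hz, Finset.sum_eq_zero fun i _ => ?_⟩
  have := hzero i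
  rw [key] at this
  linarith [hzw i, hul i]

end LCP

theorem stmt_5 {m n : ℕ}
    (A C : Matrix (Fin m) (Fin n) ℝ) (b d : Fin m → ℝ)
    (hrank : C.rank = m)
    (M : Matrix (Fin m) (Fin m) ℝ) (hM : M = A * Cᵀ * (C * Cᵀ)⁻¹)
    -- `M` is row sufficient, i.e. `Mᵀ` is column sufficient:
    (hrowsuff : ∀ z : Fin m → ℝ,
      (∀ i, z i * (Mᵀ.mulVec z) i ≤ 0) → ∀ i, z i * (Mᵀ.mulVec z) i = 0)
    -- feasibility:
    (x₀ : Fin n → ℝ) (hx₀A : ∀ i, 0 ≤ (A.mulVec x₀ - b) i) (hx₀C : ∀ i, 0 ≤ (C.mulVec x₀ - d) i) :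
    ∃ x : Fin n → ℝ, (∀ i, 0 ≤ (A.mulVec x - b) i) ∧ (∀ i, 0 ≤ (C.mulVec x - d) i) ∧
      ∑ i, (A.mulVec x - b) i * (C.mulVec x - d) i = 0 := by
  have hunit : IsUnit (C * Cᵀ).det := by
    rw [← isUnit_iff_isUnit_det, ← linearIndependent_cols_iff_isUnit,
      linearIndependent_iff_card_eq_finrank_span, Set.finrank, ← rank_eq_finrank_span_cols,
      rank_self_mul_transpose, hrank, Fintype.card_fin]
  obtain ⟨u, hu, hu0⟩ := exists_lcpObjective_eq_zero
    (q := A *ᵥ x₀ - b - M *ᵥ (C *ᵥ x₀ - d)) hrowsuff (z₀ := C *ᵥ x₀ - d)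
    ⟨hx₀C, fun i => by simpa using hx₀A i⟩
  have hA : A *ᵥ (x₀ + (Cᵀ * (C * Cᵀ)⁻¹) *ᵥ (u - (C *ᵥ x₀ - d))) - b =
      M *ᵥ u + (A *ᵥ x₀ - b - M *ᵥ (C *ᵥ x₀ - d)) := by
    rw [mulVec_add, mulVec_mulVec, ← Matrix.mul_assoc, ← hM, mulVec_sub M u]
    abel
  have hC : C *ᵥ (x₀ + (Cᵀ * (C * Cᵀ)⁻¹) *ᵥ (u - (C *ᵥ x₀ - d))) - d = u := by
    rw [mulVec_add, mulVec_mulVec, ← Matrix.mul_assoc, mul_nonsing_inv _ hunit, one_mulVec]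
    abel
  refine ⟨x₀ + (Cᵀ * (C * Cᵀ)⁻¹) *ᵥ (u - (C *ᵥ x₀ - d)), ?_, ?_, ?_⟩
  · rw [hA]
    exact hu.2
  · rw [hC]
    exact hu.1
  · rw [hA, hC, ← hu0]
    exact Finset.sum_congr rfl fun i _ => mul_comm _ _
end

section
/- Let A, C ∈ ℝ^{m×n} with C of full row rank m, let b, d ∈ ℝ^m, and set M = A Cᵀ (C Cᵀ)⁻¹ ∈ ℝ^{m×m}. Suppose M is copositive-plus and that {z ∈ ℝ^m : (M + Mᵀ)z = 0} ⊆ {z ∈ ℝ^m : (Md − b)ᵀ z = 0}. Then the vertical linear complementarity system is solvable: there exists x ∈ ℝ^n with Ax − b ≥ 0, Cx − d ≥ 0, and (Ax − b)ᵀ(Cx − d) = 0. -/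
open scoped BigOperators
open Matrix

/-- The point of parameter `t` on the segment from `a` to `c` lies in the relative interior of the
facet `{x | x i = 0}` of the nonnegative orthant. -/
def CrossesFacet {ι : Type*} (a c : ι → ℝ) (i : ι) (t : ℝ) : Prop :=
  (1 - t) * a i + t * c i = 0 ∧ ∀ j, j ≠ i → 0 < (1 - t) * a j + t * c j

lemma exists_pos_of_crossesFacet {ι : Type*} [Fintype ι] {a c : ι → ℝ} {i : ι} (hai : a i < 0)
    (hci : 0 < c i) {t : ℝ} (ht : t ∈ Set.Icc (0 : ℝ) 1) (h : CrossesFacet a c i t) :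
    ∃ t ∈ Set.Icc (0 : ℝ) 1, ∀ j, 0 < (1 - t) * a j + t * c j := by
  have ht1 : t < 1 := by
    refine lt_of_le_of_ne ht.2 ?_
    rintro rfl
    linarith [h.1]
  have key : ∀ᶠ r in nhdsWithin t (Set.Ioi t), ∀ j, 0 < (1 - r) * a j + r * c j := by
    rw [Filter.eventually_all]
    intro j
    by_cases hj : j = i
    · subst hj
      filter_upwards [self_mem_nhdsWithin] with r hr
      have hr' : t < r := hr
      nlinarith [h.1, mul_pos (sub_pos.2 hr') (sub_pos.2 (hai.trans hci))]
    · apply Filter.Eventually.filter_mono nhdsWithin_le_nhds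
      have hcont : Continuous fun r : ℝ => (1 - r) * a j + r * c j := by fun_prop
      exact hcont.continuousAt.eventually (lt_mem_nhds (h.2 j hj))
  obtain ⟨r, hr, hr'⟩ := (key.and (Ioc_mem_nhdsGT ht1)).exists
  exact ⟨r, ⟨ht.1.trans hr'.1.le, hr'.2⟩, hr⟩

open Classical in
lemma ite_add_card_crossesFacet_neg {ι : Type*} [Fintype ι] {a c : ι → ℝ} (ha : ∀ i, a i ≠ 0)
    (hgen : ∀ i j, i ≠ j → a i * c j ≠ a j * c i) :
    (if ∀ i, 0 < a i then 1 else 0) + (Finset.univ.filter fun i =>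
      (a i < 0 ∧ 0 < c i) ∧ ∃ t ∈ Set.Icc (0 : ℝ) 1, CrossesFacet a c i t).card =
    if ∃ t ∈ Set.Icc (0 : ℝ) 1, ∀ i, 0 < (1 - t) * a i + t * c i then 1 else 0 := by
  by_cases hE : ∃ t ∈ Set.Icc (0 : ℝ) 1, ∀ i, 0 < (1 - t) * a i + t * c i
  · rw [if_pos hE]
    by_cases hpos : ∀ i, 0 < a i
    · rw [if_pos hpos]
      simp only [Nat.add_eq_left, Finset.card_eq_zero, Finset.filter_eq_empty_iff]
      rintro i - ⟨⟨h, -⟩, -⟩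
      exact absurd (hpos i) h.not_gt
    · rw [if_neg hpos, zero_add, Finset.card_eq_one]
      obtain ⟨r, ⟨hr0, hr1⟩, hr⟩ := hE
      push Not at hpos
      obtain ⟨k, hk⟩ := hpos
      have hneg : ∀ i, a i < 0 → 0 < c i := by
        intro i hi
        by_contra hc
        nlinarith [hr i]
      obtain ⟨i, hi, hmax⟩ := Finset.exists_max_image (Finset.univ.filter fun i => a i < 0)
        (fun i => a i / (a i - c i)) ⟨k, by simpa using lt_of_le_of_ne hk (ha k)⟩
      simp only [Finset.mem_filter, Finset.mem_univ, true_and] at hi hmax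
      have hci := hneg i hi
      have hd : 0 < c i - a i := by linarith
      set t := a i / (a i - c i) with ht
      have hval : (1 - t) * a i + t * c i = 0 := by
        rw [ht]; field_simp [show a i - c i ≠ 0 by linarith]; ring
      have ht0 : 0 ≤ t := by
        rw [ht]; exact div_nonneg_of_nonpos hi.le (by linarith)
      have htr : t < r := by
        by_contra hcon
        nlinarith [hr i, mul_nonneg (sub_nonneg.2 (not_lt.1 hcon)) hd.le]
      have hcross : CrossesFacet a c i t := by
        refine ⟨hval, fun j hj => ?_⟩
        rcases lt_or_gt_of_ne (ha j) with hj' | hj'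
        · have hcj := hneg j hj'
          have hle := hmax j hj'
          have hne : a j / (a j - c j) ≠ t := by
            intro he
            rw [ht, div_eq_div_iff (by linarith) (by linarith)] at he
            exact hgen i j (Ne.symm hj) (by linarith)
          have hlt := lt_of_le_of_ne hle hne
          rw [div_lt_iff_of_neg (by linarith)] at hlt
          linarith
        · have h1 := hr j
          have hr0' : 0 < r := lt_of_le_of_lt ht0 htr
          have : 0 < r * ((1 - t) * a j + t * c j) := by
            have e : r * ((1 - t) * a j + t * c j) =
              t * ((1 - r) * a j + r * c j) + (r - t) * a j := by ring
            rw [e]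
            have := mul_nonneg ht0 h1.le
            have := mul_pos (sub_pos.2 htr) hj'
            linarith
          exact pos_of_mul_pos_right this hr0'.le
      refine ⟨i, Finset.eq_singleton_iff_unique_mem.2 ⟨?_, ?_⟩⟩
      · simpa using ⟨⟨hi, hci⟩, t, ⟨ht0, by linarith⟩, hcross⟩
      · intro j hj
        simp only [Finset.mem_filter, Finset.mem_univ, true_and] at hj
        obtain ⟨⟨haj, hcj⟩, s, -, hs, hs'⟩ := hj
        by_contra hne
        have h1 := hs' i (Ne.symm hne)
        have h2 := hcross.2 j hne
        have h3 : t < s := by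
          by_contra hcon
          nlinarith [mul_nonneg (sub_nonneg.2 (not_lt.1 hcon)) hd.le]
        nlinarith [mul_pos (sub_pos.2 h3) (show 0 < c j - a j by linarith)]
  · rw [if_neg hE, if_neg fun h => hE ⟨0, by simp, by simpa using h⟩]
    simp only [zero_add, Finset.card_eq_zero, Finset.filter_eq_empty_iff]
    rintro i - ⟨⟨h1, h2⟩, t, ht, h⟩
    exact hE (exists_pos_of_crossesFacet h1 h2 ht h)

lemma CrossesFacet.symm {ι : Type*} {a c : ι → ℝ} {i : ι} {t : ℝ} (h : CrossesFacet a c i t) :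
    CrossesFacet c a i (1 - t) :=
  ⟨by linarith [h.1], fun j hj => by linarith [h.2 j hj]⟩

open Classical in
/-- A segment in general position with respect to the nonnegative orthant has an even number of
positive endpoints and facet crossings in total. -/
lemma even_card_crossesFacet {ι : Type*} [Fintype ι] {a c : ι → ℝ} (ha : ∀ i, a i ≠ 0)
    (hc : ∀ i, c i ≠ 0) (hgen : ∀ i j, i ≠ j → a i * c j ≠ a j * c i) :
    Even ((if ∀ i, 0 < a i then 1 else 0) + (if ∀ i, 0 < c i then 1 else 0) +
      (Finset.univ.filter fun i => ∃ t ∈ Set.Icc (0 : ℝ) 1, CrossesFacet a c i t).card) := by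
  have hswap : ∀ a c : ι → ℝ, ∀ i, (∃ t ∈ Set.Icc (0 : ℝ) 1, CrossesFacet a c i t) →
      ∃ t ∈ Set.Icc (0 : ℝ) 1, CrossesFacet c a i t := by
    rintro a c i ⟨t, ht, h⟩
    exact ⟨1 - t, ⟨by linarith [ht.2], by linarith [ht.1]⟩, h.symm⟩
  have h1 := ite_add_card_crossesFacet_neg ha hgen
  have h2 := ite_add_card_crossesFacet_neg (a := c) (c := a) hc
    fun i j hij h => hgen j i hij.symm (by linarith)
  have hE : (∃ t ∈ Set.Icc (0 : ℝ) 1, ∀ i, 0 < (1 - t) * c i + t * a i) ↔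
      ∃ t ∈ Set.Icc (0 : ℝ) 1, ∀ i, 0 < (1 - t) * a i + t * c i := by
    constructor <;>
    · rintro ⟨t, ht, h⟩
      exact ⟨1 - t, ⟨by linarith [ht.2], by linarith [ht.1]⟩, fun i => by linarith [h i]⟩
  rw [if_congr hE rfl rfl, ← h1] at h2
  have hsplit : (Finset.univ.filter fun i => ∃ t ∈ Set.Icc (0 : ℝ) 1, CrossesFacet a c i t) =
      (Finset.univ.filter fun i =>
        (a i < 0 ∧ 0 < c i) ∧ ∃ t ∈ Set.Icc (0 : ℝ) 1, CrossesFacet a c i t) ∪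
      (Finset.univ.filter fun i =>
        (c i < 0 ∧ 0 < a i) ∧ ∃ t ∈ Set.Icc (0 : ℝ) 1, CrossesFacet c a i t) := by
    ext i
    simp only [Finset.mem_filter, Finset.mem_univ, true_and, Finset.mem_union]
    constructor
    · intro h
      obtain ⟨t, ⟨ht0, ht1⟩, hv, -⟩ := id h
      rcases lt_or_gt_of_ne (ha i) with hai | hai
      · refine Or.inl ⟨⟨hai, lt_of_le_of_ne ?_ (hc i).symm⟩, h⟩
        by_contra hcon
        rcases ht0.eq_or_lt with rfl | ht0
        · linarith
        · nlinarith
      · refine Or.inr ⟨⟨lt_of_le_of_ne ?_ (hc i), hai⟩, hswap _ _ _ h⟩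
        by_contra hcon
        rcases ht0.eq_or_lt with rfl | ht0
        · linarith
        · nlinarith
    · rintro (⟨-, h⟩ | ⟨-, h⟩)
      exacts [h, hswap _ _ _ h]
  rw [hsplit, Finset.card_union_of_disjoint]
  · rw [Nat.even_iff]
    omega
  · rw [Finset.disjoint_filter]
    rintro i - ⟨⟨h, -⟩, -⟩ ⟨⟨-, h'⟩, -⟩
    linarith

section ComplementaryCones

variable {ι : Type*} [Fintype ι] [DecidableEq ι]

/-- The complementary matrix of `M` associated with `s`: its columns are those of `-M` on `s` and
those of the identity matrix off `s`. -/
def complementaryMatrix (M : Matrix ι ι ℝ) (s : Finset ι) : Matrix ι ι ℝ :=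
  fun i j => if j ∈ s then -M i j else (1 : Matrix ι ι ℝ) i j

lemma complementaryMatrix_mulVec (M : Matrix ι ι ℝ) (s : Finset ι) (u : ι → ℝ) :
    complementaryMatrix M s *ᵥ u =
      (fun i => if i ∈ s then 0 else u i) - M *ᵥ (fun i => if i ∈ s then u i else 0) := by
  ext i
  have h : (if i ∈ s then 0 else u i) = ∑ j, (1 : Matrix ι ι ℝ) i j * if j ∈ s then 0 else u j :=
    (congrFun (one_mulVec fun j => if j ∈ s then 0 else u j) i).symm
  simp only [Pi.sub_apply, mulVec, dotProduct, h, ← Finset.sum_sub_distrib, complementaryMatrix]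
  refine Finset.sum_congr rfl fun j _ => ?_
  split_ifs <;> ring

lemma complementaryMatrix_symmDiff_mulVec (M : Matrix ι ι ℝ) (s : Finset ι) {i : ι} {u : ι → ℝ}
    (hu : u i = 0) :
    complementaryMatrix M (symmDiff s {i}) *ᵥ u = complementaryMatrix M s *ᵥ u := by
  ext k
  refine Finset.sum_congr rfl fun j _ => ?_
  by_cases hj : j = i
  · subst hj; simp [hu]
  · simp [complementaryMatrix, Finset.mem_symmDiff, hj]

/-- The coordinates of `q` with respect to the columns of a complementary matrix. -/
noncomputable def complementaryCoords (M : Matrix ι ι ℝ) (s : Finset ι) (q : ι → ℝ) : ι → ℝ :=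
  (complementaryMatrix M s)⁻¹ *ᵥ q

lemma complementaryMatrix_mulVec_coords {M : Matrix ι ι ℝ} {s : Finset ι}
    (h : IsUnit (complementaryMatrix M s).det) (q : ι → ℝ) :
    complementaryMatrix M s *ᵥ complementaryCoords M s q = q := by
  simp [complementaryCoords, Matrix.mul_nonsing_inv _ h]

lemma complementaryCoords_mulVec {M : Matrix ι ι ℝ} {s : Finset ι}
    (h : IsUnit (complementaryMatrix M s).det) (u : ι → ℝ) :
    complementaryCoords M s (complementaryMatrix M s *ᵥ u) = u := by
  simp [complementaryCoords, Matrix.nonsing_inv_mul _ h]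

lemma complementaryCoords_segment (M : Matrix ι ι ℝ) (s : Finset ι) (p q : ι → ℝ) (t : ℝ) (i : ι) :
    complementaryCoords M s ((1 - t) • p + t • q) i =
      (1 - t) * complementaryCoords M s p i + t * complementaryCoords M s q i := by
  simp [complementaryCoords, mulVec_add, mulVec_smul]

lemma complementaryCoords_symmDiff {M : Matrix ι ι ℝ}
    (hM : ∀ s, IsUnit (complementaryMatrix M s).det) {s : Finset ι} {i : ι} {q : ι → ℝ}
    (h : complementaryCoords M s q i = 0) :
    complementaryCoords M (symmDiff s {i}) q = complementaryCoords M s q := by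
  have h1 := complementaryMatrix_symmDiff_mulVec M s h
  rw [complementaryMatrix_mulVec_coords (hM s)] at h1
  conv_lhs => rw [← h1]
  exact complementaryCoords_mulVec (hM _) _

lemma CrossesFacet.complementary_symmDiff {M : Matrix ι ι ℝ}
    (hM : ∀ s, IsUnit (complementaryMatrix M s).det) {s : Finset ι} {i : ι} {p q : ι → ℝ} {t : ℝ}
    (h : CrossesFacet (complementaryCoords M s p) (complementaryCoords M s q) i t) :
    CrossesFacet (complementaryCoords M (symmDiff s {i}) p)
      (complementaryCoords M (symmDiff s {i}) q) i t := by
  simp only [CrossesFacet, ← complementaryCoords_segment] at h ⊢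
  rwa [complementaryCoords_symmDiff hM h.1]

open Classical in
/-- The number of complementary cones containing a generic point is constant modulo two. -/
lemma even_card_complementaryCones {M : Matrix ι ι ℝ}
    (hM : ∀ s, IsUnit (complementaryMatrix M s).det) {p q : ι → ℝ}
    (hp : ∀ s i, complementaryCoords M s p i ≠ 0) (hq : ∀ s i, complementaryCoords M s q i ≠ 0)
    (hgen : ∀ s i j, i ≠ j → complementaryCoords M s p i * complementaryCoords M s q j ≠
      complementaryCoords M s p j * complementaryCoords M s q i) :
    Even ((Finset.univ.filter fun s => ∀ i, 0 < complementaryCoords M s p i).card +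
      (Finset.univ.filter fun s => ∀ i, 0 < complementaryCoords M s q i).card) := by
  set X : Finset ι → Finset ι := fun s => Finset.univ.filter fun i => ∃ t ∈ Set.Icc (0 : ℝ) 1,
    CrossesFacet (complementaryCoords M s p) (complementaryCoords M s q) i t with hX
  have hsum := Finset.even_sum (s := (Finset.univ : Finset (Finset ι))) _ fun s _ =>
    even_card_crossesFacet (hp s) (hq s) (hgen s)
  simp only [Finset.sum_add_distrib, ← Finset.card_filter] at hsum
  refine (Nat.even_add.1 hsum).2 ?_
  change Even (∑ s, (X s).card)
  rw [← Finset.card_sigma, ← ZMod.natCast_eq_zero_iff_even, Finset.card_eq_sum_ones, Nat.cast_sum]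
  refine Finset.sum_involution (fun a _ => ⟨symmDiff a.1 {a.2}, a.2⟩) ?_ ?_ ?_ ?_
  · intros; decide
  · rintro ⟨s, i⟩ - - h
    have h' := congrArg Sigma.fst h
    simp at h'
  · rintro ⟨s, i⟩ h
    simp only [hX, Finset.mem_sigma, Finset.mem_filter, Finset.mem_univ, true_and] at h ⊢
    obtain ⟨t, ht, h⟩ := h
    exact ⟨t, ht, h.complementary_symmDiff hM⟩
  · rintro ⟨s, i⟩ -
    simp

lemma dotProduct_mulVec_complementaryMatrix (M : Matrix ι ι ℝ) (s : Finset ι) (u : ι → ℝ) :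
    (fun i => if i ∈ s then u i else 0) ⬝ᵥ complementaryMatrix M s *ᵥ u =
      -((fun i => if i ∈ s then u i else 0) ⬝ᵥ M *ᵥ (fun i => if i ∈ s then u i else 0)) := by
  rw [complementaryMatrix_mulVec, dotProduct_sub, sub_eq_neg_self]
  refine Finset.sum_eq_zero fun i _ => ?_
  by_cases h : i ∈ s <;> simp [h]

lemma eq_empty_of_complementaryCoords_pos {M : Matrix ι ι ℝ}
    (hM : ∀ s, IsUnit (complementaryMatrix M s).det)
    (hcop : ∀ z : ι → ℝ, (∀ i, 0 ≤ z i) → 0 ≤ z ⬝ᵥ M *ᵥ z) {p : ι → ℝ} (hp : ∀ i, 0 < p i)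
    {s : Finset ι} (hs : ∀ i, 0 < complementaryCoords M s p i) : s = ∅ := by
  by_contra hne
  obtain ⟨k, hk⟩ := Finset.nonempty_iff_ne_empty.2 hne
  have h := dotProduct_mulVec_complementaryMatrix M s (complementaryCoords M s p)
  rw [complementaryMatrix_mulVec_coords (hM s)] at h
  set z : ι → ℝ := fun i => if i ∈ s then complementaryCoords M s p i else 0 with hz
  have hz0 : ∀ i, 0 ≤ z i := by
    intro i
    simp only [hz]
    split_ifs
    exacts [(hs i).le, le_rfl]
  have : 0 < z ⬝ᵥ p := Finset.sum_pos' (fun i _ => mul_nonneg (hz0 i) (hp i).le)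
    ⟨k, Finset.mem_univ _, mul_pos (by simpa [hz, hk] using hs k) (hp k)⟩
  linarith [hcop z hz0]

lemma isOpen_dense_setOf_dotProduct_complementaryCoords_ne_zero {M : Matrix ι ι ℝ} {s : Finset ι}
    (h : IsUnit (complementaryMatrix M s).det) {x : ι → ℝ} (hx : x ≠ 0) :
    IsOpen {q | x ⬝ᵥ complementaryCoords M s q ≠ 0} ∧
      Dense {q | x ⬝ᵥ complementaryCoords M s q ≠ 0} := by
  constructor
  · refine isOpen_ne_fun ?_ continuous_const
    unfold complementaryCoords
    fun_prop
  · intro q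
    set v := complementaryMatrix M s *ᵥ x
    have hlim : Filter.Tendsto (fun t : ℝ => q + t • v) (nhdsWithin 0 {0}ᶜ) (nhds q) := by
      have : Continuous fun t : ℝ => q + t • v := by fun_prop
      simpa using (this.tendsto 0).mono_left nhdsWithin_le_nhds
    have hval : ∀ t : ℝ, x ⬝ᵥ complementaryCoords M s (q + t • v) =
        x ⬝ᵥ complementaryCoords M s q + t * (x ⬝ᵥ x) := by
      intro t
      have := complementaryCoords_mulVec h x
      unfold complementaryCoords at this ⊢
      rw [mulVec_add, mulVec_smul, this, dotProduct_add, dotProduct_smul, smul_eq_mul]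
    have hxx : x ⬝ᵥ x ≠ 0 := by simpa using hx
    by_cases h0 : x ⬝ᵥ complementaryCoords M s q = 0
    · refine mem_closure_of_tendsto hlim ?_
      filter_upwards [self_mem_nhdsWithin] with t ht
      rw [hval, h0, zero_add]
      exact mul_ne_zero ht hxx
    · exact subset_closure h0

lemma dense_complementaryCoords_ne_zero {M : Matrix ι ι ℝ}
    (hM : ∀ s, IsUnit (complementaryMatrix M s).det) :
    Dense {q | ∀ s i, complementaryCoords M s q i ≠ 0} := by
  have hx : ∀ a : Finset ι × ι, (Pi.single a.2 1 : ι → ℝ) ≠ 0 := by simp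
  have h := dense_iInter_of_isOpen
    (fun a : Finset ι × ι => (isOpen_dense_setOf_dotProduct_complementaryCoords_ne_zero
      (hM a.1) (hx a)).1)
    (fun a => (isOpen_dense_setOf_dotProduct_complementaryCoords_ne_zero (hM a.1) (hx a)).2)
  refine h.mono fun q hq s i => ?_
  simpa using Set.mem_iInter.1 hq (s, i)

lemma isOpen_complementaryCoords_ne_zero (M : Matrix ι ι ℝ) :
    IsOpen {q | ∀ s i, complementaryCoords M s q i ≠ 0} := by
  simp only [Set.ofPred_forall]
  refine isOpen_iInter_of_finite fun s => isOpen_iInter_of_finite fun i =>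
    isOpen_ne_fun ?_ continuous_const
  unfold complementaryCoords
  fun_prop

lemma dense_complementaryCoords_mul_ne {M : Matrix ι ι ℝ}
    (hM : ∀ s, IsUnit (complementaryMatrix M s).det) {p : ι → ℝ}
    (hp : ∀ s i, complementaryCoords M s p i ≠ 0) :
    Dense {q |
      ∀ s i j, i ≠ j → complementaryCoords M s p i * complementaryCoords M s q j ≠
      complementaryCoords M s p j * complementaryCoords M s q i} := by
  let x : Finset ι × {a : ι × ι // a.1 ≠ a.2} → ι → ℝ := fun a =>
    complementaryCoords M a.1 p a.2.1.1 • Pi.single a.2.1.2 1 -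
      complementaryCoords M a.1 p a.2.1.2 • Pi.single a.2.1.1 1
  have hx : ∀ a, x a ≠ 0 := by
    rintro ⟨s, ⟨i, j⟩, hij⟩ h
    have hj := congrFun h j
    simp only [ne_eq] at hij
    simp [x, hp, Ne.symm hij] at hj
  have h : Dense (⋂ a, {q | x a ⬝ᵥ complementaryCoords M a.1 q ≠ 0}) := dense_iInter_of_isOpen
    (fun a => (isOpen_dense_setOf_dotProduct_complementaryCoords_ne_zero (hM a.1) (hx a)).1)
    (fun a => (isOpen_dense_setOf_dotProduct_complementaryCoords_ne_zero (hM a.1) (hx a)).2)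
  refine h.mono fun q hq s i j hij => ?_
  have hne : x (s, ⟨(i, j), hij⟩) ⬝ᵥ complementaryCoords M s q ≠ 0 :=
    Set.mem_iInter.1 hq (s, ⟨(i, j), hij⟩)
  simpa only [x, sub_dotProduct, smul_dotProduct, single_one_dotProduct, smul_eq_mul, ne_eq,
    sub_eq_zero] using hne

/-- If `M` is copositive and all its complementary matrices are invertible, then the complementary
cones cover a dense set. -/
lemma exists_mem_complementaryCone {M : Matrix ι ι ℝ}
    (hM : ∀ s, IsUnit (complementaryMatrix M s).det)
    (hcop : ∀ z : ι → ℝ, (∀ i, 0 ≤ z i) → 0 ≤ z ⬝ᵥ M *ᵥ z) {U : Set (ι → ℝ)} (hU : IsOpen U)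
    (hne : U.Nonempty) :
    ∃ s, ∃ u : ι → ℝ, (∀ i, 0 < u i) ∧ complementaryMatrix M s *ᵥ u ∈ U := by
  classical
  have hO : IsOpen {p : ι → ℝ | ∀ i, 0 < p i} := by
    simp only [Set.ofPred_forall]
    exact isOpen_iInter_of_finite fun i => isOpen_lt continuous_const (continuous_apply i)
  obtain ⟨p, hp, hp0⟩ := (dense_complementaryCoords_ne_zero hM).exists_mem_open hO ⟨1, by simp⟩
  obtain ⟨q, hgen, hq, hqU⟩ := (dense_complementaryCoords_mul_ne hM hp).exists_mem_open
    ((isOpen_complementaryCoords_ne_zero M).inter hU)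
    ((dense_complementaryCoords_ne_zero hM).inter_open_nonempty U hU hne |>.imp fun q h => h.symm)
  have hev := even_card_complementaryCones hM hp hq hgen
  have hone : (Finset.univ.filter fun s => ∀ i, 0 < complementaryCoords M s p i) = {∅} := by
    refine Finset.eq_singleton_iff_unique_mem.2 ⟨?_, fun s hs => ?_⟩
    · have h := complementaryMatrix_mulVec M ∅ p
      have he : complementaryCoords M ∅ p = p := by
        have h' : complementaryMatrix M ∅ *ᵥ p = p := by
          rw [h]; ext i; simp [mulVec, dotProduct]
        conv_lhs => rw [← h']
        exact complementaryCoords_mulVec (hM _) _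
      simpa [he] using hp0
    · exact eq_empty_of_complementaryCoords_pos hM hcop hp0 (by simpa using hs)
  rw [hone, Finset.card_singleton] at hev
  obtain ⟨s, hs⟩ : (Finset.univ.filter fun s => ∀ i, 0 < complementaryCoords M s q i).Nonempty := by
    rw [Finset.nonempty_iff_ne_empty]
    intro h
    simp [h] at hev
  refine ⟨s, complementaryCoords M s q, by simpa using hs, ?_⟩
  rwa [complementaryMatrix_mulVec_coords (hM s)]

lemma finite_setOf_not_isUnit_det_complementaryMatrix (M : Matrix ι ι ℝ) (s : Finset ι) :
    {ε : ℝ | ¬ IsUnit (complementaryMatrix (M + ε • 1) s).det}.Finite := by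
  let K : Matrix ι ι ℝ := fun i j => if i ∈ s then M i j else 0
  have hfin : {μ : ℝ | Module.End.HasEigenvalue (Matrix.toLin' K) μ}.Finite :=
    Module.End.finite_hasEigenvalue _
  refine (hfin.preimage (neg_injective.injOn)).subset fun ε hε => ?_
  have hdet : (complementaryMatrix (M + ε • 1) s).det = 0 := by
    by_contra h
    exact hε (isUnit_iff_ne_zero.2 h)
  obtain ⟨u, hu0, hu⟩ := Matrix.exists_mulVec_eq_zero_iff.2 hdet
  rw [complementaryMatrix_mulVec, sub_eq_zero, add_mulVec, smul_mulVec, one_mulVec] at hu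
  set z : ι → ℝ := fun i => if i ∈ s then u i else 0 with hz
  have hz0 : z ≠ 0 := by
    intro h
    apply hu0
    ext i
    have h1 := congrFun hu i
    have h2 := congrFun h i
    by_cases hi : i ∈ s
    · simpa [hz, hi] using h2
    · simpa [h, hi] using h1
  refine Module.End.hasEigenvalue_of_hasEigenvector (x := z) ⟨?_, hz0⟩
  rw [Module.End.mem_eigenspace_iff, Matrix.toLin'_apply]
  ext i
  have h1 := congrFun hu i
  by_cases hi : i ∈ s
  · have hK : (K *ᵥ z) i = (M *ᵥ z) i := by simp [mulVec, dotProduct, K, hi]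
    simp only [hi, if_true, Pi.add_apply, Pi.smul_apply, smul_eq_mul] at h1 ⊢
    linarith
  · have hK : (K *ᵥ z) i = 0 := by simp [mulVec, dotProduct, K, hi]
    rw [hK]
    simp [hz, hi]

/-- Arbitrarily small perturbations of a copositive linear complementarity problem are solvable. -/
lemma exists_solution_perturbation {M : Matrix ι ι ℝ}
    (hcop : ∀ z : ι → ℝ, (∀ i, 0 ≤ z i) → 0 ≤ z ⬝ᵥ M *ᵥ z) (q : ι → ℝ) {δ : ℝ} (hδ : 0 < δ) :
    ∃ s : Finset ι, ∃ ε ∈ Set.Ioo 0 δ, ∃ p : ι → ℝ, (∀ i, p i ∈ Set.Ioo (q i) (q i + δ)) ∧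
      ∃ z : ι → ℝ, (∀ i, 0 ≤ z i) ∧ (∀ i ∉ s, z i = 0) ∧
        (∀ i, 0 ≤ (M *ᵥ z) i + ε * z i + p i) ∧ ∀ i ∈ s, (M *ᵥ z) i + ε * z i + p i = 0 := by
  have hfin : (⋃ s : Finset ι,
      {ε : ℝ | ¬ IsUnit (complementaryMatrix (M + ε • 1) s).det}).Finite :=
    Set.finite_iUnion (finite_setOf_not_isUnit_det_complementaryMatrix M)
  obtain ⟨ε, hε, hε'⟩ := ((Set.Ioo_infinite hδ).sdiff hfin).nonempty
  have hM : ∀ s, IsUnit (complementaryMatrix (M + ε • 1) s).det := by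
    simpa only [Set.mem_iUnion, not_exists, Set.mem_ofPred_eq, not_not] using hε'
  have hcop' : ∀ z : ι → ℝ, (∀ i, 0 ≤ z i) → 0 ≤ z ⬝ᵥ (M + ε • 1) *ᵥ z := by
    intro z hz
    rw [add_mulVec, smul_mulVec, one_mulVec, dotProduct_add, dotProduct_smul, smul_eq_mul]
    exact add_nonneg (hcop z hz) (mul_nonneg hε.1.le
      (Finset.sum_nonneg fun i _ => mul_self_nonneg _))
  have hU : IsOpen {p : ι → ℝ | ∀ i, p i ∈ Set.Ioo (q i) (q i + δ)} := by
    simp only [Set.ofPred_forall]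
    exact isOpen_iInter_of_finite fun i => isOpen_Ioo.preimage (continuous_apply i)
  obtain ⟨s, u, hu, hp⟩ := exists_mem_complementaryCone hM hcop' hU
    ⟨fun i => q i + δ / 2, fun i => ⟨by linarith, by linarith⟩⟩
  have hval : ∀ i, (M *ᵥ fun i => if i ∈ s then u i else 0) i +
      ε * (if i ∈ s then u i else 0) + (complementaryMatrix (M + ε • 1) s *ᵥ u) i =
      if i ∈ s then 0 else u i := by
    intro i
    rw [complementaryMatrix_mulVec, add_mulVec, smul_mulVec, one_mulVec]
    simp only [Pi.sub_apply, Pi.add_apply, Pi.smul_apply, smul_eq_mul]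
    ring
  refine ⟨s, ε, hε, _, hp, fun i => if i ∈ s then u i else 0, fun i => ?_, fun i hi => if_neg hi,
    fun i => ?_, fun i hi => ?_⟩
  · dsimp only
    split_ifs
    exacts [(hu i).le, le_rfl]
  · rw [hval]
    split_ifs
    exacts [le_rfl, (hu i).le]
  · rw [hval, if_pos hi]

lemma exists_support_forall_solution_perturbation {M : Matrix ι ι ℝ}
    (hcop : ∀ z : ι → ℝ, (∀ i, 0 ≤ z i) → 0 ≤ z ⬝ᵥ M *ᵥ z) (q : ι → ℝ) :
    ∃ s : Finset ι, ∀ δ : ℝ, 0 < δ →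
      ∃ ε ∈ Set.Ioo 0 δ, ∃ p : ι → ℝ, (∀ i, p i ∈ Set.Ioo (q i) (q i + δ)) ∧
      ∃ z : ι → ℝ, (∀ i, 0 ≤ z i) ∧ (∀ i ∉ s, z i = 0) ∧
        (∀ i, 0 ≤ (M *ᵥ z) i + ε * z i + p i) ∧ ∀ i ∈ s, (M *ᵥ z) i + ε * z i + p i = 0 := by
  by_contra hcon
  rw [not_exists] at hcon
  simp only [not_forall] at hcon
  choose δ hδ hno using hcon
  obtain ⟨s₀, -, hmin⟩ := Finset.exists_min_image Finset.univ δ ⟨∅, Finset.mem_univ _⟩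
  obtain ⟨s, ε, hε, p, hp, h⟩ := exists_solution_perturbation hcop q (hδ s₀)
  have hle := hmin s (Finset.mem_univ _)
  exact hno s ⟨ε, ⟨hε.1, hε.2.trans_le hle⟩, p,
    fun i => ⟨(hp i).1, (hp i).2.trans_le (by linarith)⟩, h⟩

/-- Existence of solutions of linear complementarity problems with a copositive-plus matrix. -/
theorem exists_solution_of_copositivePlus {M : Matrix ι ι ℝ}
    (hcop : ∀ z : ι → ℝ, (∀ i, 0 ≤ z i) → 0 ≤ z ⬝ᵥ M *ᵥ z)
    (hplus : ∀ z : ι → ℝ, (∀ i, 0 ≤ z i) → z ⬝ᵥ M *ᵥ z = 0 → (M + Mᵀ) *ᵥ z = 0) {q : ι → ℝ}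
    (hq : ∀ z : ι → ℝ, (∀ i, 0 ≤ z i) → (M + Mᵀ) *ᵥ z = 0 → 0 ≤ q ⬝ᵥ z) :
    ∃ z : ι → ℝ, (∀ i, 0 ≤ z i) ∧ (∀ i, 0 ≤ (M *ᵥ z + q) i) ∧
      ∀ i, (M *ᵥ z + q) i * z i = 0 := by
  obtain ⟨s, hs⟩ := exists_support_forall_solution_perturbation hcop q
  choose ε hε p hp z hz hzs hw hws using fun k : ℕ => hs (1 / ((k : ℝ) + 1)) (by positivity)
  have hδ := tendsto_one_div_add_atTop_nhds_zero_nat (𝕜 := ℝ)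
  have hεlim : Filter.Tendsto ε Filter.atTop (nhds 0) :=
    squeeze_zero (fun k => (hε k).1.le) (fun k => (hε k).2.le) hδ
  have hplim : ∀ i, Filter.Tendsto (fun k => p k i) Filter.atTop (nhds (q i)) := fun i =>
    tendsto_of_tendsto_of_tendsto_of_le_of_le tendsto_const_nhds
      (by simpa using hδ.const_add (q i)) (fun k => (hp k i).1.le) (fun k => (hp k i).2.le)
  let l : ℕ → ℝ := fun k => (1 + ‖z k‖)⁻¹
  have hl : ∀ k, 0 < l k := fun k => by positivity
  have hnorm : ∀ k, ‖l k • z k‖ + l k = 1 := by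
    intro k
    rw [norm_smul, Real.norm_of_nonneg (hl k).le]
    have : (1 + ‖z k‖) ≠ 0 := by positivity
    simp only [l]
    field_simp
    ring
  have hmem : ∀ k, (l k • z k, l k) ∈ Metric.closedBall (0 : (ι → ℝ) × ℝ) 1 := by
    intro k
    rw [mem_closedBall_zero_iff, Prod.norm_mk, max_le_iff, Real.norm_of_nonneg (hl k).le]
    constructor <;> linarith [hnorm k, hl k, norm_nonneg (l k • z k)]
  obtain ⟨⟨y, r⟩, -, φ, hφ, hlim⟩ := (isCompact_closedBall _ _).tendsto_subseq hmem
  have hy : Filter.Tendsto (fun k => l (φ k) • z (φ k)) Filter.atTop (nhds y) :=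
    (continuous_fst.tendsto _).comp hlim
  have hr : Filter.Tendsto (fun k => l (φ k)) Filter.atTop (nhds r) :=
    (continuous_snd.tendsto _).comp hlim
  have hyi := tendsto_pi_nhds.1 hy
  have hyr : ‖y‖ + r = 1 :=
    tendsto_nhds_unique (hy.norm.add hr) (by simp only [hnorm]; exact tendsto_const_nhds)
  have hr0 : 0 ≤ r := ge_of_tendsto' hr fun k => (hl _).le
  have hy0 : ∀ i, 0 ≤ y i := fun i =>
    ge_of_tendsto' (hyi i) fun k => mul_nonneg (hl _).le (hz _ i)
  have hys : ∀ i ∉ s, y i = 0 := fun i hi =>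
    tendsto_nhds_unique (hyi i) (by simp [hzs _ i hi])
  have hv : ∀ i, Filter.Tendsto (fun k => l (φ k) *
      ((M *ᵥ z (φ k)) i + ε (φ k) * z (φ k) i + p (φ k) i)) Filter.atTop
      (nhds ((M *ᵥ y) i + r * q i)) := by
    intro i
    have h1 : Filter.Tendsto (fun k => (M *ᵥ (l (φ k) • z (φ k))) i) Filter.atTop
        (nhds ((M *ᵥ y) i)) := by
      have : Continuous fun x : ι → ℝ => (M *ᵥ x) i := by fun_prop
      exact (this.tendsto y).comp hy
    have h2 := (hεlim.comp hφ.tendsto_atTop).mul (hyi i)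
    have h3 := hr.mul ((hplim i).comp hφ.tendsto_atTop)
    have h4 := (h1.add h2).add h3
    rw [zero_mul, add_zero] at h4
    refine h4.congr fun k => ?_
    simp only [mulVec_smul, Pi.smul_apply, smul_eq_mul, Function.comp_apply]
    ring
  have hv0 : ∀ i, 0 ≤ (M *ᵥ y) i + r * q i := fun i =>
    ge_of_tendsto' (hv i) fun k => mul_nonneg (hl _).le (hw _ i)
  have hvs : ∀ i ∈ s, (M *ᵥ y) i + r * q i = 0 := fun i hi =>
    tendsto_nhds_unique (hv i) (by simp [hws _ i hi])
  rcases hr0.eq_or_lt with rfl | hr0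
  · exfalso
    simp only [zero_mul, add_zero] at hv0 hvs hyr
    have horth : ∀ x : ι → ℝ, (∀ i ∉ s, x i = 0) → x ⬝ᵥ M *ᵥ y = 0 := by
      intro x hx
      refine Finset.sum_eq_zero fun i _ => ?_
      by_cases hi : i ∈ s
      · rw [hvs i hi, mul_zero]
      · rw [hx i hi, zero_mul]
    have hker := hplus y hy0 (horth y hys)
    have hqy := hq y hy0 hker
    have h1 : z 0 ⬝ᵥ (M + Mᵀ) *ᵥ y = y ⬝ᵥ M *ᵥ z 0 := by
      rw [add_mulVec, dotProduct_add, horth _ (hzs 0), zero_add, mulVec_transpose,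
        dotProduct_comm, dotProduct_mulVec]
    rw [hker, dotProduct_zero] at h1
    have h2 : y ⬝ᵥ M *ᵥ z 0 + ε 0 * (y ⬝ᵥ z 0) + p 0 ⬝ᵥ y = 0 := by
      simp only [dotProduct, Finset.mul_sum, ← Finset.sum_add_distrib]
      refine Finset.sum_eq_zero fun i _ => ?_
      by_cases hi : i ∈ s
      · linear_combination y i * hws 0 i hi
      · rw [hys i hi]; ring
    have h3 : 0 ≤ y ⬝ᵥ z 0 := Finset.sum_nonneg fun i _ => mul_nonneg (hy0 i) (hz 0 i)
    obtain ⟨k, hk⟩ : ∃ k, y k ≠ 0 := Function.ne_iff.1 (by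
      rintro rfl
      simp at hyr : y ≠ 0)
    have h4 : q ⬝ᵥ y < p 0 ⬝ᵥ y := Finset.sum_lt_sum
      (fun i _ => mul_le_mul_of_nonneg_right (hp 0 i).1.le (hy0 i))
      ⟨k, Finset.mem_univ _, mul_lt_mul_of_pos_right (hp 0 k).1 (lt_of_le_of_ne (hy0 k) hk.symm)⟩
    linarith [mul_nonneg (hε 0).1.le h3]
  · have hval : ∀ i, (M *ᵥ (r⁻¹ • y) + q) i = r⁻¹ * ((M *ᵥ y) i + r * q i) := by
      intro i
      simp only [mulVec_smul, Pi.add_apply, Pi.smul_apply, smul_eq_mul]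
      field_simp
    refine ⟨r⁻¹ • y, fun i => mul_nonneg (inv_nonneg.2 hr0.le) (hy0 i), fun i => ?_, fun i => ?_⟩
    · rw [hval]
      exact mul_nonneg (inv_nonneg.2 hr0.le) (hv0 i)
    · by_cases hi : i ∈ s
      · rw [hval, hvs i hi, mul_zero, zero_mul]
      · simp [hys i hi]

end ComplementaryCones

lemma isUnit_det_self_mul_transpose {m n : ℕ} {C : Matrix (Fin m) (Fin n) ℝ} (h : C.rank = m) :
    IsUnit (C * Cᵀ).det := by
  rw [← Matrix.isUnit_iff_isUnit_det, ← mulVec_surjective_iff_isUnit]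
  have hr : (C * Cᵀ).rank = m := by rw [rank_self_mul_transpose, h]
  have htop : LinearMap.range (C * Cᵀ).mulVecLin = ⊤ :=
    Submodule.eq_top_of_finrank_eq (by rw [← Matrix.rank, hr]; simp)
  exact LinearMap.range_eq_top.1 htop

theorem stmt_6 {m n : ℕ}
    (A C : Matrix (Fin m) (Fin n) ℝ) (b d : Fin m → ℝ)
    (hrank : C.rank = m)
    (M : Matrix (Fin m) (Fin m) ℝ) (hM : M = A * Cᵀ * (C * Cᵀ)⁻¹)
    -- `M` is copositive:
    (hcopos : ∀ z : Fin m → ℝ, (∀ i, 0 ≤ z i) → 0 ≤ z ⬝ᵥ M.mulVec z)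
    -- `M` is copositive-plus:
    (hplus : ∀ z : Fin m → ℝ, (∀ i, 0 ≤ z i) → z ⬝ᵥ M.mulVec z = 0 → (M + Mᵀ).mulVec z = 0)
    -- kernel inclusion:
    (hker : ∀ z : Fin m → ℝ, (M + Mᵀ).mulVec z = 0 → (M.mulVec d - b) ⬝ᵥ z = 0) :
    ∃ x : Fin n → ℝ, (∀ i, 0 ≤ (A.mulVec x - b) i) ∧ (∀ i, 0 ≤ (C.mulVec x - d) i) ∧
      ∑ i, (A.mulVec x - b) i * (C.mulVec x - d) i = 0 := by
  obtain ⟨z, hz, hw, hzw⟩ := exists_solution_of_copositivePlus hcopos hplus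
    (q := M *ᵥ d - b) fun z _ h => (hker z h).ge
  have hdet := isUnit_det_self_mul_transpose hrank
  have hA : A *ᵥ ((Cᵀ * (C * Cᵀ)⁻¹) *ᵥ (z + d)) - b = M *ᵥ z + (M *ᵥ d - b) := by
    rw [mulVec_mulVec, ← Matrix.mul_assoc, ← hM, mulVec_add, add_sub_assoc]
  have hC : C *ᵥ ((Cᵀ * (C * Cᵀ)⁻¹) *ᵥ (z + d)) - d = z := by
    rw [mulVec_mulVec, ← Matrix.mul_assoc, Matrix.mul_nonsing_inv _ hdet, one_mulVec,
      add_sub_cancel_right]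
  refine ⟨(Cᵀ * (C * Cᵀ)⁻¹) *ᵥ (z + d), ?_, ?_, ?_⟩
  · rwa [hA]
  · rwa [hC]
  · rw [hA, hC]
    exact Finset.sum_eq_zero fun i _ => hzw i
end
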